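/- Let (p(n))_{n∈ℕ} be an ensemble of probability vectors, where p(n) = (p₁,…,pₙ) satisfies Σᵢpᵢ = 1 and p₁ ≥ p₂ ≥ … ≥ pₙ > 0, and suppose p₁² = o(Σ_{i=1}^n pᵢ²) as n → ∞. Then non-uniform random 2-SAT has a sharp satisfiability threshold at m*(n) = (Σ_{i=1}^n pᵢ²)^{-1}: for every constant ε > 0, if m(n) ≤ (1−ε)·m*(n) then Pr(Φ satisfiable) = 1−o(1), and if m(n) ≥ (1+ε)·m*(n) then Pr(Φ satisfiable) = o(1). -/

import Mathlib

open Finset Filter Asymptotics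

open scoped Classical

/-- The probability of drawing a given ordered 2-clause (an ordered pair of literals over
distinct variables); an unordered 2-clause over variables `i ≠ j` then has total probability
`(C/2)·pᵢ·pⱼ` where `C = (1 - ∑ pᵢ²)⁻¹`. -/
noncomputable def clauseProb2 (n : ℕ) (p : ℕ → ℝ) (c : (Fin n × Bool) × (Fin n × Bool)) : ℝ :=
  if c.1.1 ≠ c.2.1 then
    (1 - ∑ i ∈ Finset.range n, p i ^ 2)⁻¹ / 4 * p c.1.1.1 * p c.2.1.1
  else 0

/-- The probability of drawing a given formula: `m` clauses drawn independently. -/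
noncomputable def formulaProb2 (n m : ℕ) (p : ℕ → ℝ)
    (Φ : Fin m → (Fin n × Bool) × (Fin n × Bool)) : ℝ :=
  ∏ j, clauseProb2 n p (Φ j)

/-- Satisfiability of a 2-CNF formula: a literal `(x, b)` is satisfied by an assignment `a`
iff `a x = b`. -/
def Sat2 {n m : ℕ} (Φ : Fin m → (Fin n × Bool) × (Fin n × Bool)) : Prop :=
  ∃ a : Fin n → Bool, ∀ j, a (Φ j).1.1 = (Φ j).1.2 ∨ a (Φ j).2.1 = (Φ j).2.2

/-- The probability that a non-uniform random 2-SAT formula with `n` variables, `m` clauses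
and variable distribution `p` is satisfiable. -/
noncomputable def probSat2 (n m : ℕ) (p : ℕ → ℝ) : ℝ :=
  ∑ Φ : Fin m → (Fin n × Bool) × (Fin n × Bool),
    if Sat2 Φ then formulaProb2 n m p Φ else 0

/-- The probability that a non-uniform random 2-SAT formula is unsatisfiable. -/
noncomputable def probUnsat2 (n m : ℕ) (p : ℕ → ℝ) : ℝ :=
  ∑ Φ : Fin m → (Fin n × Bool) × (Fin n × Bool),
    if ¬ Sat2 Φ then formulaProb2 n m p Φ else 0

/-- The normalization constant `C = (1 - ∑ pᵢ²)⁻¹`. -/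
noncomputable def Cconst (n : ℕ) (p : ℕ → ℝ) : ℝ :=
  (1 - ∑ i ∈ Finset.range n, p i ^ 2)⁻¹

/-- The maximum clause probability `q_max = (C/2)·p₁·p₂`. -/
noncomputable def qmax2 (n : ℕ) (p : ℕ → ℝ) : ℝ :=
  Cconst n p / 2 * p 0 * p 1

/-- `p n` is a probability vector on `n` variables (indexed `0,…,n-1`), sorted decreasingly,
with all entries positive. -/
def ProbEnsemble (p : ℕ → ℕ → ℝ) : Prop :=
  ∀ n, 1 ≤ n →
    (∑ i ∈ Finset.range n, p n i = 1) ∧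
    (∀ i j, i ≤ j → j < n → p n j ≤ p n i) ∧
    (∀ i, i < n → 0 < p n i)


set_option linter.unusedSectionVars false

section ProbA

variable {α : Type*} [Fintype α] [DecidableEq α]

/-- expectation -/
noncomputable def Ex (m : ℕ) (w : α → ℝ) (F : (Fin m → α) → ℝ) : ℝ :=
  ∑ Φ : Fin m → α, (∏ j, w (Φ j)) * F Φ

/-- count -/
noncomputable def cnt {m : ℕ} (A : Finset α) (Φ : Fin m → α) : ℝ :=
  ∑ j, if Φ j ∈ A then (1:ℝ) else 0

/-- indicator -/
noncomputable def ind (A : Finset α) (c : α) : ℝ := if c ∈ A then (1:ℝ) else 0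

/-- weight -/
noncomputable def wt (w : α → ℝ) (A : Finset α) : ℝ := ∑ c, w c * ind A c

lemma ind_nonneg (A : Finset α) (c : α) : 0 ≤ ind A c := by
  unfold ind; split_ifs <;> norm_num

lemma wt_nonneg {w : α → ℝ} (hw : ∀ c, 0 ≤ w c) (A : Finset α) : 0 ≤ wt w A :=
  Finset.sum_nonneg fun c _ => mul_nonneg (hw c) (ind_nonneg A c)

lemma cnt_nonneg {m : ℕ} (A : Finset α) (Φ : Fin m → α) : 0 ≤ cnt A Φ :=
  Finset.sum_nonneg fun j _ => by split_ifs <;> norm_num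

lemma Ex_sum {m : ℕ} {w : α → ℝ} {κ : Type*} (s : Finset κ) (F : κ → (Fin m → α) → ℝ) :
    Ex m w (fun Φ => ∑ k ∈ s, F k Φ) = ∑ k ∈ s, Ex m w (F k) := by
  unfold Ex
  rw [Finset.sum_comm]
  refine Finset.sum_congr rfl fun Φ _ => ?_
  rw [Finset.mul_sum]

lemma Ex_mul_left {m : ℕ} {w : α → ℝ} (a : ℝ) (F : (Fin m → α) → ℝ) :
    Ex m w (fun Φ => a * F Φ) = a * Ex m w F := by
  unfold Ex
  rw [Finset.mul_sum]
  refine Finset.sum_congr rfl fun Φ _ => by ring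

lemma Ex_mono {m : ℕ} {w : α → ℝ} (hw : ∀ c, 0 ≤ w c) {F G : (Fin m → α) → ℝ}
    (h : ∀ Φ, (∏ j, w (Φ j)) ≠ 0 → F Φ ≤ G Φ) : Ex m w F ≤ Ex m w G := by
  unfold Ex
  refine Finset.sum_le_sum fun Φ _ => ?_
  by_cases h0 : (∏ j, w (Φ j)) = 0
  · simp [h0]
  · exact mul_le_mul_of_nonneg_left (h Φ h0) (Finset.prod_nonneg fun j _ => hw _)

lemma Ex_prod {m : ℕ} (w : α → ℝ) (G : Fin m → α → ℝ) :
    Ex m w (fun Φ => ∏ j, G j (Φ j)) = ∏ j, ∑ c, w c * G j c := by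
  unfold Ex
  rw [Finset.prod_univ_sum, Fintype.piFinset_univ]
  refine Finset.sum_congr rfl fun Φ _ => by rw [Finset.prod_mul_distrib]

lemma Ex_one {m : ℕ} {w : α → ℝ} (h1 : ∑ c, w c = 1) : Ex m w (fun _ => 1) = 1 := by
  have := Ex_prod (m := m) w (fun _ _ => 1)
  simpa [h1] using this

lemma prod_cnt {m : ℕ} {ι : Type*} [Fintype ι] [DecidableEq ι] (A : ι → Finset α) (Φ : Fin m → α) :
    ∏ i, cnt (A i) Φ = ∑ f : ι → Fin m, ∏ i, ind (A i) (Φ (f i)) := by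
  unfold cnt
  rw [Finset.prod_univ_sum, Fintype.piFinset_univ]
  rfl

lemma prod_fib {m : ℕ} {ι : Type*} [Fintype ι] [DecidableEq ι] (f : ι → Fin m) (F : ι → ℝ) :
    ∏ i, F i = ∏ j, ∏ i ∈ Finset.univ.filter (fun i => f i = j), F i := by
  rw [Finset.prod_fiberwise]

lemma prod_fib' {m : ℕ} {ι : Type*} [Fintype ι] [DecidableEq ι] (f : ι → Fin m)
    (F : ι → Fin m → ℝ) :
    ∏ i, F i (f i) = ∏ j, ∏ i ∈ Finset.univ.filter (fun i => f i = j), F i j := by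
  rw [prod_fib f]
  refine Finset.prod_congr rfl fun j _ => Finset.prod_congr rfl fun i hi => ?_
  rw [(Finset.mem_filter.mp hi).2]

lemma fib_inj {m : ℕ} {ι : Type*} [Fintype ι] [DecidableEq ι] (f : ι → Fin m)
    (hf : Function.Injective f) (j : Fin m) :
    (Finset.univ.filter (fun i => f i = j) = ∅ ∧ ∀ i, f i ≠ j) ∨
    ∃ i, f i = j ∧ Finset.univ.filter (fun i => f i = j) = {i} := by
  by_cases h : ∃ i, f i = j
  · right
    obtain ⟨i, hi⟩ := h
    refine ⟨i, hi, ?_⟩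
    ext i'
    simp only [Finset.mem_filter, Finset.mem_univ, true_and, Finset.mem_singleton]
    constructor
    · intro h; exact hf (h.trans hi.symm)
    · rintro rfl; exact hi
  · left
    push Not at h
    refine ⟨?_, h⟩
    ext i'
    simp [h i']

lemma prod_ind_zero {m : ℕ} {ι : Type*} [Fintype ι] [DecidableEq ι] {A : ι → Finset α}
    (hA : ∀ i j, i ≠ j → Disjoint (A i) (A j)) {f : ι → Fin m}
    (hf : ¬ Function.Injective f) (Φ : Fin m → α) : ∏ i, ind (A i) (Φ (f i)) = 0 := by
  simp only [Function.Injective] at hf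
  push Not at hf
  obtain ⟨i, j, hij, hne⟩ := hf
  by_cases h : Φ (f i) ∈ A i
  · have h2 : Φ (f j) ∉ A j := by
      rw [← hij]
      exact Finset.disjoint_left.mp (hA i j hne) h
    exact Finset.prod_eq_zero (Finset.mem_univ j) (by simp [ind, h2])
  · exact Finset.prod_eq_zero (Finset.mem_univ i) (by simp [ind, h])

lemma Ex_zero {m : ℕ} {w : α → ℝ} : Ex m w (fun _ => 0) = 0 := by simp [Ex]

lemma Ex_f {m : ℕ} {w : α → ℝ} (h1 : ∑ c, w c = 1) {ι : Type*} [Fintype ι] [DecidableEq ι]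
    (A : ι → Finset α) (f : ι → Fin m) (hf : Function.Injective f) :
    Ex m w (fun Φ => ∏ i, ind (A i) (Φ (f i))) = ∏ i, wt w (A i) := by
  have e : (fun Φ : Fin m → α => ∏ i, ind (A i) (Φ (f i))) = fun Φ => ∏ j,
      (fun j c => ∏ i ∈ Finset.univ.filter (fun i => f i = j), ind (A i) c) j (Φ j) := by
    funext Φ
    exact prod_fib' f (fun i j => ind (A i) (Φ j))
  have e2 := (congrArg (Ex m w) e).trans (Ex_prod w
    (fun j c => ∏ i ∈ Finset.univ.filter (fun i => f i = j), ind (A i) c))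
  rw [e2, prod_fib f (fun i => wt w (A i))]
  refine Finset.prod_congr rfl fun j _ => ?_
  rcases fib_inj f hf j with ⟨h, _⟩ | ⟨i, _, h⟩
  · simp [h, h1]
  · simp [h, wt]

lemma card_inj {m : ℕ} {ι : Type*} [Fintype ι] [DecidableEq ι] :
    (∑ f : ι → Fin m, if Function.Injective f then (1:ℝ) else 0)
      = (m.descFactorial (Fintype.card ι) : ℝ) := by
  rw [Finset.sum_boole]
  congr 1
  have := Fintype.card_embedding_eq (α := ι) (β := Fin m)
  rw [Fintype.card_fin] at this
  rw [← this, ← Fintype.card_subtype]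
  exact Fintype.card_congr (Equiv.subtypeInjectiveEquivEmbedding ι (Fin m))

lemma first_moment {m : ℕ} {w : α → ℝ} (h1 : ∑ c, w c = 1)
    {ι : Type*} [Fintype ι] [DecidableEq ι] (A : ι → Finset α)
    (hA : ∀ i j, i ≠ j → Disjoint (A i) (A j)) :
    Ex m w (fun Φ => ∏ i, cnt (A i) Φ)
      = (m.descFactorial (Fintype.card ι) : ℝ) * ∏ i, wt w (A i) := by
  simp_rw [prod_cnt]
  rw [Ex_sum, ← card_inj, Finset.sum_mul]
  refine Finset.sum_congr rfl fun f _ => ?_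
  split_ifs with hf
  · rw [Ex_f h1 A f hf, one_mul]
  · simp_rw [prod_ind_zero hA hf]
    rw [Ex_zero, zero_mul]

lemma first_moment_le {m : ℕ} {w : α → ℝ} (hw : ∀ c, 0 ≤ w c) (h1 : ∑ c, w c = 1)
    {ι : Type*} [Fintype ι] [DecidableEq ι] (A : ι → Finset α)
    (hA : ∀ i j, i ≠ j → Disjoint (A i) (A j)) :
    Ex m w (fun Φ => ∏ i, cnt (A i) Φ) ≤ ∏ i, ((m:ℝ) * wt w (A i)) := by
  rw [first_moment h1 A hA, Finset.prod_mul_distrib, Finset.prod_const, Finset.card_univ]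
  refine mul_le_mul_of_nonneg_right ?_ (Finset.prod_nonneg fun i _ => wt_nonneg hw _)
  exact_mod_cast Nat.descFactorial_le_pow m _

lemma Ex_fg {m : ℕ} {w : α → ℝ} (hw : ∀ c, 0 ≤ w c) (h1 : ∑ c, w c = 1)
    {ι κ : Type*} [Fintype ι] [DecidableEq ι] [Fintype κ] [DecidableEq κ]
    (A : ι → Finset α) (B : κ → Finset α)
    (hAB : ∀ i k, A i = B k ∨ Disjoint (A i) (B k))
    (f : ι → Fin m) (hf : Function.Injective f) (g : κ → Fin m) (hg : Function.Injective g) :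
    Ex m w (fun Φ => (∏ i, ind (A i) (Φ (f i))) * ∏ k, ind (B k) (Φ (g k)))
      ≤ (∏ i, wt w (A i)) * ∏ k, ((if ∃ i, f i = g k ∧ A i = B k then (1:ℝ) else 0) +
          if ∃ i, f i = g k then 0 else wt w (B k)) := by
  have e : (fun Φ : Fin m → α => (∏ i, ind (A i) (Φ (f i))) * ∏ k, ind (B k) (Φ (g k))) =
    fun Φ => ∏ j,
      (fun j c => (∏ i ∈ Finset.univ.filter (fun i => f i = j), ind (A i) c) *
        ∏ k ∈ Finset.univ.filter (fun k => g k = j), ind (B k) c) j (Φ j) := by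
    funext Φ
    rw [Finset.prod_mul_distrib, ← prod_fib' f (fun i j => ind (A i) (Φ j)),
      ← prod_fib' g (fun i j => ind (B i) (Φ j))]
  have e2 := (congrArg (Ex m w) e).trans (Ex_prod w
    (fun j c => (∏ i ∈ Finset.univ.filter (fun i => f i = j), ind (A i) c) *
        ∏ k ∈ Finset.univ.filter (fun k => g k = j), ind (B k) c))
  rw [e2, prod_fib f (fun i => wt w (A i)),
    prod_fib' g (fun k j => (if ∃ i, f i = j ∧ A i = B k then (1:ℝ) else 0) +
          if ∃ i, f i = j then 0 else wt w (B k)), ← Finset.prod_mul_distrib]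
  refine Finset.prod_le_prod (fun j _ => Finset.sum_nonneg fun c _ => mul_nonneg (hw c)
    (mul_nonneg (Finset.prod_nonneg fun i _ => ind_nonneg _ _)
      (Finset.prod_nonneg fun i _ => ind_nonneg _ _))) fun j _ => ?_
  rcases fib_inj f hf j with ⟨h, h'⟩ | ⟨i, hi, h⟩ <;>
  rcases fib_inj g hg j with ⟨k1, _⟩ | ⟨k, hk, k1⟩
  · simp [h, k1, h1]
  · have : ¬ ∃ i, f i = j := by push Not; exact h'
    have h2 : ¬ ∃ i, f i = j ∧ A i = B k := fun ⟨i, hi, _⟩ => h' i hi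
    simp [h, k1, this, h2, wt]
  · simp [h, k1, wt]
  · have h3 : ∃ i, f i = j := ⟨i, hi⟩
    simp only [h, k1, Finset.prod_singleton, h3, if_true, add_zero]
    rcases hAB i k with hE | hD
    · have : ∃ i, f i = j ∧ A i = B k := ⟨i, hi, hE⟩
      simp only [this, if_true, mul_one, wt]
      refine Finset.sum_le_sum fun c _ => mul_le_mul_of_nonneg_left ?_ (hw c)
      unfold ind; split_ifs <;> norm_num
    · have : ∑ c, w c * (ind (A i) c * ind (B k) c) = 0 := by
        refine Finset.sum_eq_zero fun c _ => ?_
        by_cases hc : c ∈ A i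
        · simp [ind, Finset.disjoint_left.mp hD hc]
        · simp [ind, hc]
      rw [this]
      refine mul_nonneg (wt_nonneg hw _) ?_
      split_ifs <;> norm_num

lemma second_moment {m : ℕ} {w : α → ℝ} (hw : ∀ c, 0 ≤ w c) (h1 : ∑ c, w c = 1)
    {ι κ : Type*} [Fintype ι] [DecidableEq ι] [Fintype κ] [DecidableEq κ]
    (A : ι → Finset α) (B : κ → Finset α)
    (hA : ∀ i j, i ≠ j → Disjoint (A i) (A j)) (hAi : Function.Injective A)
    (hB : ∀ i j, i ≠ j → Disjoint (B i) (B j))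
    (hAB : ∀ i k, A i = B k ∨ Disjoint (A i) (B k)) :
    Ex m w (fun Φ => (∏ i, cnt (A i) Φ) * ∏ k, cnt (B k) Φ)
      ≤ (∏ i, ((m:ℝ) * wt w (A i))) *
        ∏ k, ((m:ℝ) * wt w (B k) + if ∃ i, A i = B k then (1:ℝ) else 0) := by
  simp_rw [prod_cnt, Finset.sum_mul_sum]
  rw [Ex_sum]
  have key : ∀ f : ι → Fin m, Ex m w (fun Φ => ∑ g : κ → Fin m,
      (∏ i, ind (A i) (Φ (f i))) * ∏ k, ind (B k) (Φ (g k))) ≤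
      (∏ i, wt w (A i)) * 
        ∏ k, ((m:ℝ) * wt w (B k) + if ∃ i, A i = B k then (1:ℝ) else 0) := by
    intro f
    have hr : 0 ≤ (∏ i, wt w (A i)) * 
        ∏ k, ((m:ℝ) * wt w (B k) + if ∃ i, A i = B k then (1:ℝ) else 0) := by
      refine mul_nonneg (Finset.prod_nonneg fun i _ => wt_nonneg hw _)
        (Finset.prod_nonneg fun k _ => ?_)
      have := wt_nonneg hw (B k)
      split_ifs <;> positivity
    by_cases hf : Function.Injective f
    · rw [Ex_sum]
      set h : κ → Fin m → ℝ := fun k j => (if ∃ i, f i = j ∧ A i = B k then (1:ℝ) else 0) +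
          if ∃ i, f i = j then 0 else wt w (B k) with hh
      have hn : ∀ k j, 0 ≤ h k j := by
        intro k j
        have := wt_nonneg hw (B k)
        simp only [hh]
        split_ifs <;> positivity
      calc _ ≤ ∑ g : κ → Fin m, (∏ i, wt w (A i)) * ∏ k, h k (g k) := by
            refine Finset.sum_le_sum fun g _ => ?_
            by_cases hg : Function.Injective g
            · exact Ex_fg hw h1 A B hAB f hf g hg
            · simp_rw [prod_ind_zero hB hg, mul_zero]
              rw [Ex_zero]
              exact mul_nonneg (Finset.prod_nonneg fun i _ => wt_nonneg hw _)
                (Finset.prod_nonneg fun k _ => hn _ _)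
        _ = (∏ i, wt w (A i)) * ∏ k, ∑ j, h k j := by
            rw [Finset.prod_univ_sum, Fintype.piFinset_univ, Finset.mul_sum]
        _ ≤ _ := by
            refine mul_le_mul_of_nonneg_left ?_ (Finset.prod_nonneg fun i _ => wt_nonneg hw _)
            refine Finset.prod_le_prod (fun k _ => Finset.sum_nonneg fun j _ => hn _ _)
              fun k _ => ?_
            simp only [hh]
            rw [Finset.sum_add_distrib, add_comm]
            refine add_le_add ?_ ?_
            · calc _ ≤ ∑ j : Fin m, wt w (B k) := by
                    refine Finset.sum_le_sum fun j _ => ?_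
                    have := wt_nonneg hw (B k)
                    split_ifs <;> linarith
                _ = _ := by simp
            · split_ifs with hE
              · obtain ⟨i, hi⟩ := hE
                have : ∀ j, (if ∃ i, f i = j ∧ A i = B k then (1:ℝ) else 0)
                    = if j = f i then 1 else 0 := by
                  intro j
                  congr 1
                  apply propext
                  constructor
                  · rintro ⟨i', h2, h3⟩
                    rw [← h2, hAi (h3.trans hi.symm)]
                  · rintro rfl
                    exact ⟨i, rfl, hi⟩
                simp [this]
              · refine le_of_eq (Finset.sum_eq_zero fun j _ => ?_)
                rw [if_neg]
                rintro ⟨i, _, h⟩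
                exact hE ⟨i, h⟩
    · simp_rw [prod_ind_zero hA hf, zero_mul, Finset.sum_const_zero]
      rw [Ex_zero]
      exact hr
  refine (Finset.sum_le_sum fun f _ => key f).trans (le_of_eq ?_)
  rw [Finset.sum_const, Finset.prod_mul_distrib, Finset.prod_const]
  simp [mul_assoc]

lemma cauchy_pos {m : ℕ} {w : α → ℝ} (hw : ∀ c, 0 ≤ w c) (X : (Fin m → α) → ℝ)
    (hX : ∀ Φ, 0 ≤ X Φ) :
    (Ex m w X) ^ 2 ≤ Ex m w (fun Φ => if 0 < X Φ then 1 else 0) * Ex m w (fun Φ => X Φ ^ 2) := by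
  unfold Ex
  have hp : ∀ Φ : Fin m → α, 0 ≤ ∏ j, w (Φ j) := fun Φ => Finset.prod_nonneg fun j _ => hw _
  have := Finset.sum_mul_sq_le_sq_mul_sq Finset.univ
    (fun Φ : Fin m → α => Real.sqrt (∏ j, w (Φ j)) * if 0 < X Φ then 1 else 0)
    (fun Φ : Fin m → α => Real.sqrt (∏ j, w (Φ j)) * X Φ)
  have e1 : ∑ Φ : Fin m → α, (∏ j, w (Φ j)) * X Φ = ∑ Φ : Fin m → α,
      (Real.sqrt (∏ j, w (Φ j)) * if 0 < X Φ then 1 else 0) * (Real.sqrt (∏ j, w (Φ j)) * X Φ) := by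
    refine Finset.sum_congr rfl fun Φ _ => ?_
    have h := Real.mul_self_sqrt (hp Φ)
    split_ifs with h0
    · linear_combination (-X Φ) * h
    · have : X Φ = 0 := le_antisymm (not_lt.mp h0) (hX Φ)
      simp [this]
  have e2 : ∑ Φ : Fin m → α, (∏ j, w (Φ j)) * (if 0 < X Φ then (1:ℝ) else 0) = ∑ Φ : Fin m → α,
      (Real.sqrt (∏ j, w (Φ j)) * if 0 < X Φ then 1 else 0) ^ 2 := by
    refine Finset.sum_congr rfl fun Φ _ => ?_
    have h := Real.mul_self_sqrt (hp Φ)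
    split_ifs with h0
    · linear_combination -h
    · simp
  have e3 : ∑ Φ : Fin m → α, (∏ j, w (Φ j)) * (X Φ) ^ 2 = ∑ Φ : Fin m → α,
      (Real.sqrt (∏ j, w (Φ j)) * X Φ) ^ 2 := by
    refine Finset.sum_congr rfl fun Φ _ => ?_
    have h := Real.mul_self_sqrt (hp Φ)
    linear_combination (-X Φ^2) * h
  rw [e1, e2, e3]
  exact this

end ProbA

section LitB

/-- negation of literal -/
def lneg {n : ℕ} (a : Fin n × Bool) : Fin n × Bool := (a.1, !a.2)

@[simp] lemma lneg_lneg {n : ℕ} (a : Fin n × Bool) : lneg (lneg a) = a := by simp [lneg]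
@[simp] lemma lneg_fst {n : ℕ} (a : Fin n × Bool) : (lneg a).1 = a.1 := rfl
lemma lneg_ne {n : ℕ} (a : Fin n × Bool) : lneg a ≠ a := by
  intro h
  have := congrArg Prod.snd h
  simp [lneg] at this
lemma lneg_inj {n : ℕ} {a b : Fin n × Bool} (h : lneg a = lneg b) : a = b := by
  rw [← lneg_lneg a, h, lneg_lneg]
lemma lneg_injective {n : ℕ} : Function.Injective (lneg (n := n)) := fun _ _ h => lneg_inj h
lemma eq_or_lneg {n : ℕ} {a b : Fin n × Bool} (h : a.1 = b.1) : a = b ∨ a = lneg b := by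
  obtain ⟨x, s⟩ := a
  obtain ⟨y, t⟩ := b
  simp only at h
  subst h
  cases s <;> cases t <;> simp [lneg]

/-- clauses realizing the implication `a → b` -/
def Ev {n : ℕ} (a b : Fin n × Bool) : Finset ((Fin n × Bool) × (Fin n × Bool)) :=
  {(lneg a, b), (b, lneg a)}

lemma mem_Ev {n : ℕ} {a b : Fin n × Bool} {c : (Fin n × Bool) × (Fin n × Bool)} :
    c ∈ Ev a b ↔ c = (lneg a, b) ∨ c = (b, lneg a) := by simp [Ev]

lemma Ev_contra {n : ℕ} (a b : Fin n × Bool) : Ev (lneg b) (lneg a) = Ev a b := by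
  ext c
  simp only [mem_Ev, lneg_lneg]
  tauto

lemma Ev_meet {n : ℕ} {a b c d : Fin n × Bool} {x} (h1 : x ∈ Ev a b) (h2 : x ∈ Ev c d) :
    (a = c ∧ b = d) ∨ (a = lneg d ∧ b = lneg c) := by
  rw [mem_Ev] at h1 h2
  rcases h1 with rfl | rfl <;> rcases h2 with h | h <;> simp only [Prod.mk.injEq] at h
  · exact Or.inl ⟨lneg_inj h.1, h.2⟩
  · refine Or.inr ⟨?_, h.2⟩
    rw [← h.1, lneg_lneg]
  · refine Or.inr ⟨?_, h.1⟩
    rw [← h.2, lneg_lneg]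
  · exact Or.inl ⟨lneg_inj h.2, h.1⟩

lemma Ev_eq_of {n : ℕ} {a b c d : Fin n × Bool}
    (h : (a = c ∧ b = d) ∨ (a = lneg d ∧ b = lneg c)) : Ev a b = Ev c d := by
  rcases h with ⟨rfl, rfl⟩ | ⟨rfl, rfl⟩
  · rfl
  · exact Ev_contra _ _

lemma Ev_eq_iff {n : ℕ} {a b c d : Fin n × Bool} :
    Ev a b = Ev c d ↔ (a = c ∧ b = d) ∨ (a = lneg d ∧ b = lneg c) := by
  refine ⟨fun h => ?_, Ev_eq_of⟩
  have h1 : (lneg a, b) ∈ Ev a b := by simp [mem_Ev]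
  exact Ev_meet h1 (h ▸ h1)

lemma Ev_disj {n : ℕ} {a b c d : Fin n × Bool}
    (h : ¬ ((a = c ∧ b = d) ∨ (a = lneg d ∧ b = lneg c))) : Disjoint (Ev a b) (Ev c d) := by
  rw [Finset.disjoint_left]
  intro x h1 h2
  exact h (Ev_meet h1 h2)

lemma Ev_eq_or_disj {n : ℕ} (a b c d : Fin n × Bool) :
    Ev a b = Ev c d ∨ Disjoint (Ev a b) (Ev c d) := by
  by_cases h : (a = c ∧ b = d) ∨ (a = lneg d ∧ b = lneg c)
  · exact Or.inl (Ev_eq_of h)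
  · exact Or.inr (Ev_disj h)

/-- good probability vector -/
structure GoodP (n : ℕ) (p : ℕ → ℝ) : Prop where
  sum1 : ∑ i : Fin n, p i = 1
  pos : ∀ i : Fin n, 0 < p i
  lt1 : ∑ i ∈ Finset.range n, p i ^ 2 < 1

lemma clauseProb_nonneg {n : ℕ} {p : ℕ → ℝ} (h : GoodP n p) (c) : 0 ≤ clauseProb2 n p c := by
  unfold clauseProb2
  have h1 : 0 < (1 - ∑ i ∈ Finset.range n, p i ^ 2)⁻¹ := inv_pos.mpr (by linarith [h.lt1])
  have h2 := h.pos c.1.1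
  have h3 := h.pos c.2.1
  split_ifs
  · positivity
  · exact le_rfl

lemma clauseProb_sum {n : ℕ} {p : ℕ → ℝ} (h : GoodP n p) : ∑ c, clauseProb2 n p c = 1 := by
  set C := (1 - ∑ i ∈ Finset.range n, p i ^ 2)⁻¹ with hC
  have e : ∀ c : (Fin n × Bool) × (Fin n × Bool), clauseProb2 n p c =
      C / 4 * (p c.1.1 * p c.2.1) - C / 4 * (if c.1.1 = c.2.1 then p c.1.1 * p c.2.1 else 0) := by
    intro c
    unfold clauseProb2
    rw [← hC]
    by_cases hc : c.1.1 = c.2.1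
    · simp [hc]
    · simp [hc]; ring
  simp_rw [e]
  rw [Finset.sum_sub_distrib, ← Finset.mul_sum, ← Finset.mul_sum]
  have s1 : ∑ c : (Fin n × Bool) × (Fin n × Bool), p c.1.1 * p c.2.1 = 4 := by
    rw [Fintype.sum_prod_type]
    simp_rw [← Finset.mul_sum, ← Finset.sum_mul, Fintype.sum_prod_type]
    simp [← Finset.mul_sum, h.sum1]
    norm_num
  have s2 : ∑ c : (Fin n × Bool) × (Fin n × Bool),
      (if c.1.1 = c.2.1 then p c.1.1 * p c.2.1 else 0) = 4 * ∑ i ∈ Finset.range n, p i ^ 2 := by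
    rw [Fintype.sum_prod_type]
    simp_rw [Fintype.sum_prod_type]
    simp [← Finset.mul_sum, Finset.sum_range]
    ring_nf
  rw [s1, s2]
  have : (1 - ∑ i ∈ Finset.range n, p i ^ 2) ≠ 0 := by linarith [h.lt1]
  rw [hC]
  field_simp

lemma wt_Ev {n : ℕ} {p : ℕ → ℝ} {a b : Fin n × Bool} (hab : a.1 ≠ b.1) :
    wt (clauseProb2 n p) (Ev a b) =
      (1 - ∑ i ∈ Finset.range n, p i ^ 2)⁻¹ / 2 * p a.1 * p b.1 := by
  unfold wt ind
  simp only [mul_ite, mul_one, mul_zero]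
  rw [← Finset.sum_filter]
  have : Finset.univ.filter (fun c => c ∈ Ev a b) = Ev a b := by ext; simp
  rw [this, Ev, Finset.sum_pair]
  · have e1 : clauseProb2 n p (lneg a, b) =
        (1 - ∑ i ∈ Finset.range n, p i ^ 2)⁻¹ / 4 * p a.1 * p b.1 := by
      simp [clauseProb2, hab]
    have e2 : clauseProb2 n p (b, lneg a) =
        (1 - ∑ i ∈ Finset.range n, p i ^ 2)⁻¹ / 4 * p b.1 * p a.1 := by
      simp [clauseProb2, hab.symm]
    rw [e1, e2]
    ring
  · intro h
    exact hab (congrArg (fun x => x.1.1) h)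

lemma wt_Ev_le {n : ℕ} {p : ℕ → ℝ} (h : GoodP n p) (a b : Fin n × Bool) :
    wt (clauseProb2 n p) (Ev a b) ≤
      (1 - ∑ i ∈ Finset.range n, p i ^ 2)⁻¹ / 2 * p a.1 * p b.1 := by
  by_cases hab : a.1 = b.1
  · have h1 : 0 < (1 - ∑ i ∈ Finset.range n, p i ^ 2)⁻¹ := inv_pos.mpr (by linarith [h.lt1])
    have h2 := h.pos a.1
    have h3 := h.pos b.1
    have : wt (clauseProb2 n p) (Ev a b) = 0 := by
      unfold wt ind
      refine Finset.sum_eq_zero fun c _ => ?_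
      split_ifs with hc
      · rw [mem_Ev] at hc
        rcases hc with rfl | rfl <;> simp [clauseProb2, hab]
      · simp
    rw [this]
    positivity
  · exact (wt_Ev hab).le

lemma cnt_pos_iff {n m : ℕ} {A : Finset ((Fin n × Bool) × (Fin n × Bool))}
    {Φ : Fin m → (Fin n × Bool) × (Fin n × Bool)} : 0 < cnt A Φ ↔ ∃ j, Φ j ∈ A := by
  unfold cnt
  rw [Finset.sum_pos_iff_of_nonneg (fun j _ => by split_ifs <;> norm_num)]
  constructor
  · rintro ⟨j, _, h⟩
    refine ⟨j, ?_⟩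
    by_contra h2
    simp [h2] at h
  · rintro ⟨j, h⟩
    exact ⟨j, Finset.mem_univ _, by simp [h]⟩

lemma one_le_cnt {n m : ℕ} {A : Finset ((Fin n × Bool) × (Fin n × Bool))}
    {Φ : Fin m → (Fin n × Bool) × (Fin n × Bool)} (h : ∃ j, Φ j ∈ A) : 1 ≤ cnt A Φ := by
  obtain ⟨j, h⟩ := h
  unfold cnt
  have := Finset.single_le_sum (f := fun j => if Φ j ∈ A then (1:ℝ) else 0)
    (fun j _ => by split_ifs <;> norm_num) (Finset.mem_univ j)
  simpa [h] using this

lemma sat_step {n m : ℕ} {Φ : Fin m → (Fin n × Bool) × (Fin n × Bool)} {A : Fin n → Bool}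
    (hA : ∀ j, A (Φ j).1.1 = (Φ j).1.2 ∨ A (Φ j).2.1 = (Φ j).2.2) {a b : Fin n × Bool}
    (h : 0 < cnt (Ev a b) Φ) (ha : A a.1 = a.2) : A b.1 = b.2 := by
  obtain ⟨j, hj⟩ := cnt_pos_iff.mp h
  have := hA j
  rw [mem_Ev] at hj
  rcases hj with hj | hj <;> rw [hj] at this <;> simp [lneg, ha] at this <;> exact this

lemma probSat_eq {n m : ℕ} {p : ℕ → ℝ} :
    probSat2 n m p = Ex m (clauseProb2 n p) (fun Φ => if Sat2 Φ then 1 else 0) := by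
  unfold probSat2 Ex formulaProb2
  refine Finset.sum_congr rfl fun Φ _ => by by_cases h : Sat2 Φ <;> simp [h]

lemma Ex_succ {α : Type*} [Fintype α] {m : ℕ} {w : α → ℝ} (F : (Fin (m+1) → α) → ℝ) :
    Ex (m+1) w F = ∑ c, w c * Ex m w (fun Φ => F (Fin.cons c Φ)) := by
  unfold Ex
  rw [← (Fin.consEquiv (fun _ : Fin (m+1) => α)).sum_comp, Fintype.sum_prod_type]
  refine Finset.sum_congr rfl fun c _ => ?_
  rw [Finset.mul_sum]
  refine Finset.sum_congr rfl fun Φ _ => ?_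
  simp [Fin.consEquiv, Fin.prod_univ_succ, mul_assoc]

lemma probSat_succ_le {n m : ℕ} {p : ℕ → ℝ} (h : GoodP n p) :
    probSat2 n (m+1) p ≤ probSat2 n m p := by
  rw [probSat_eq, probSat_eq, Ex_succ]
  calc _ ≤ ∑ c, clauseProb2 n p c * Ex m (clauseProb2 n p) (fun Φ => if Sat2 Φ then 1 else 0) := by
        refine Finset.sum_le_sum fun c _ => mul_le_mul_of_nonneg_left ?_ (clauseProb_nonneg h c)
        refine Ex_mono (clauseProb_nonneg h) fun Φ _ => ?_
        by_cases h1 : Sat2 (Fin.cons c Φ : Fin (m+1) → _)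
        · have : Sat2 Φ := by
            obtain ⟨A, hA⟩ := h1
            refine ⟨A, fun j => ?_⟩
            simpa using hA j.succ
          simp [h1, this]
        · rw [if_neg h1]
          split_ifs <;> norm_num
    _ = _ := by rw [← Finset.sum_mul, clauseProb_sum h, one_mul]

lemma probSat_anti {n : ℕ} {p : ℕ → ℝ} (h : GoodP n p) {m m' : ℕ} (hm : m ≤ m') :
    probSat2 n m' p ≤ probSat2 n m p :=
  antitone_nat_of_succ_le (f := fun m => probSat2 n m p) (fun _ => probSat_succ_le h) hm

lemma probSat_nonneg {n m : ℕ} {p : ℕ → ℝ} (h : GoodP n p) : 0 ≤ probSat2 n m p := by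
  rw [probSat_eq]
  have := Ex_mono (m := m) (clauseProb_nonneg h) (F := fun _ => 0)
    (G := fun Φ => if Sat2 Φ then 1 else 0) (fun Φ _ => by split_ifs <;> norm_num)
  rwa [Ex_zero] at this

lemma probSat_compl {n m : ℕ} {p : ℕ → ℝ} (h : GoodP n p) :
    probSat2 n m p = 1 - Ex m (clauseProb2 n p) (fun Φ => if Sat2 Φ then 0 else 1) := by
  rw [probSat_eq]
  have h1 := Ex_one (m := m) (clauseProb_sum h)
  have h2 : Ex m (clauseProb2 n p) (fun Φ => if Sat2 Φ then 1 else 0)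
      + Ex m (clauseProb2 n p) (fun Φ => if Sat2 Φ then 0 else 1)
      = Ex m (clauseProb2 n p) (fun _ => 1) := by
    unfold Ex
    rw [← Finset.sum_add_distrib]
    refine Finset.sum_congr rfl fun Φ _ => by by_cases h : Sat2 Φ <;> simp [h]
  linarith

end LitB

section PartOne

/-- implication relation -/
def RT {n : ℕ} (T : Set ((Fin n × Bool) × (Fin n × Bool))) (x y : Fin n × Bool) : Prop :=
  ∃ d ∈ T, d ∈ Ev x y

lemma RT_skew {n : ℕ} {T : Set ((Fin n × Bool) × (Fin n × Bool))} {x y : Fin n × Bool}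
    (h : RT T x y) : RT T (lneg y) (lneg x) := by
  obtain ⟨d, hd, h⟩ := h
  exact ⟨d, hd, by rwa [Ev_contra]⟩

lemma RT_skew_refl {n : ℕ} {T : Set ((Fin n × Bool) × (Fin n × Bool))} {x y : Fin n × Bool}
    (h : Relation.ReflTransGen (RT T) x y) :
    Relation.ReflTransGen (RT T) (lneg y) (lneg x) := by
  induction h with
  | refl => exact Relation.ReflTransGen.refl
  | tail _ h ih => exact Relation.ReflTransGen.head (RT_skew h) ih

lemma reach_neg {n : ℕ} {T : Set ((Fin n × Bool) × (Fin n × Bool))} {A : Fin n → Bool}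
    (hA : ∀ d ∈ T, A d.1.1 = d.1.2 ∨ A d.2.1 = d.2.2) {a : Fin n × Bool}
    (hno : ¬ ∃ A' : Fin n → Bool, (∀ d ∈ T, A' d.1.1 = d.1.2 ∨ A' d.2.1 = d.2.2) ∧ A' a.1 = a.2) :
    Relation.TransGen (RT T) a (lneg a) := by
  by_contra hcon
  have hcon' : ¬ Relation.ReflTransGen (RT T) a (lneg a) := by
    intro h
    rcases Relation.reflTransGen_iff_eq_or_transGen.mp h with h | h
    · exact lneg_ne a h
    · exact hcon h
  set reach : Fin n × Bool → Prop := fun x => Relation.ReflTransGen (RT T) a x with hr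
  have hcons : ∀ x, reach x → ¬ reach (lneg x) := by
    intro x h1 h2
    have := RT_skew_refl h1
    exact hcon' (h2.trans this)
  have hstep : ∀ x y, reach x → RT T x y → reach y := fun x y h1 h2 => h1.tail h2
  apply hno
  let A' : Fin n → Bool := fun v =>
    if reach (v, true) then true else if reach (v, false) then false else A v
  have hA' : ∀ x, reach x → A' x.1 = x.2 := by
    rintro ⟨v, b⟩ h
    cases b
    · have := hcons _ h
      simp [lneg] at this
      simp [A', this, h]
    · simp [A', h]
  have hA'' : ∀ x, ¬ reach x → ¬ reach (lneg x) → A' x.1 = A x.1 := by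
    rintro ⟨v, b⟩ h1 h2
    cases b <;> simp [lneg] at h2 <;> simp [A', h1, h2]
  refine ⟨A', fun d hd => ?_, hA' a Relation.ReflTransGen.refl⟩
  have e1 : RT T (lneg d.1) d.2 := ⟨d, hd, by simp [mem_Ev]⟩
  have e2 : RT T (lneg d.2) d.1 := ⟨d, hd, by simp [mem_Ev]⟩
  by_cases h1 : reach d.1
  · exact Or.inl (hA' _ h1)
  by_cases h2 : reach d.2
  · exact Or.inr (hA' _ h2)
  by_cases h3 : reach (lneg d.1)
  · exact absurd (hstep _ _ h3 e1) h2
  by_cases h4 : reach (lneg d.2)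
  · exact absurd (hstep _ _ h4 e2) h1
  rw [hA'' _ h1 h3, hA'' _ h2 h4]
  exact hA d hd

lemma first_repeat {n : ℕ} {R : (Fin n × Bool) → (Fin n × Bool) → Prop} {y : Fin n × Bool}
    {x : Fin n × Bool} (h : Relation.TransGen R x y) :
    ∀ F : Finset (Fin n), x.1 ∉ F → (y.1 ∈ F ∨ y.1 = x.1) →
    ∃ (z : List (Fin n × Bool)) (v : Fin n × Bool),
      List.IsChain R (x :: (z ++ [v])) ∧ ((x :: z).map Prod.fst).Nodup ∧
      (∀ u ∈ x :: z, u.1 ∉ F) ∧ (v.1 ∈ F ∨ v.1 ∈ (x :: z).map Prod.fst) := by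
  induction h using Relation.TransGen.head_induction_on with
  | @single x h =>
    intro F hx hy
    exact ⟨[], y, by simpa using h, by simp, by simpa using hx, by simpa using hy⟩
  | @head x x' h _ ih =>
    intro F hx hy
    by_cases hx' : x'.1 ∈ insert x.1 F
    · refine ⟨[], x', by simpa using h, by simp, by simpa using hx, ?_⟩
      rw [Finset.mem_insert] at hx'
      rcases hx' with h | h
      · right; simp [h]
      · left; exact h
    · obtain ⟨z, v, h1, h2, h3, h4⟩ := ih (insert x.1 F) hx' (by
        left; rw [Finset.mem_insert]; tauto)
      refine ⟨x' :: z, v, ?_, ?_, ?_, ?_⟩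
      · simpa using ⟨h, h1⟩
      · rw [List.map_cons, List.nodup_cons]
        refine ⟨?_, h2⟩
        intro hm
        obtain ⟨u, hu, he⟩ := List.mem_map.mp hm
        exact h3 u hu (by rw [he]; exact Finset.mem_insert_self _ _)
      · intro u hu
        rcases List.mem_cons.mp hu with rfl | hu
        · exact hx
        · exact fun hF => h3 u hu (Finset.mem_insert_of_mem hF)
      · rcases h4 with h | h
        · rw [Finset.mem_insert] at h
          rcases h with h | h
          · right; simp [h]
          · left; exact h
        · right; rw [List.map_cons]; exact List.mem_cons_of_mem _ h

lemma bicycle {n m : ℕ} {Φ : Fin m → (Fin n × Bool) × (Fin n × Bool)} (hΦ : ¬ Sat2 Φ) :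
    ∃ (L : List (Fin n × Bool)) (y0 y1 : Fin n × Bool),
      (L.map Prod.fst).Nodup ∧ y0.1 ∈ L.map Prod.fst ∧ y1.1 ∈ L.map Prod.fst ∧
      List.IsChain (fun x y => ∃ j, Φ j ∈ Ev x y) (y0 :: (L ++ [y1])) ∧
      ¬ (L.getLast? = some y0 ∧ L.head? = some y1) := by
  have hex : ∃ j, ¬ ∃ A : Fin n → Bool, ∀ i : Fin m, i.1 < j →
      (A (Φ i).1.1 = (Φ i).1.2 ∨ A (Φ i).2.1 = (Φ i).2.2) :=
    ⟨m, fun ⟨A, hA⟩ => hΦ ⟨A, fun i => hA i i.2⟩⟩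
  have hj := Nat.find_spec hex
  have hmin : ∀ k < Nat.find hex, _ := fun k hk => not_not.mp (Nat.find_min hex hk)
  generalize Nat.find hex = j at hj hmin
  cases j with
  | zero => exact absurd ⟨fun _ => true, fun i hi => absurd hi (by omega)⟩ hj
  | succ j =>
  obtain ⟨A, hA⟩ := hmin j (by omega)
  have hjm : j < m := by
    by_contra hjm
    exact hj ⟨A, fun i _ => hA i (by omega)⟩
  obtain ⟨a, b, hab⟩ : ∃ a b, Φ ⟨j, hjm⟩ = (a, b) := ⟨_, _, rfl⟩
  set T : Set ((Fin n × Bool) × (Fin n × Bool)) := {d | ∃ i : Fin m, i.1 < j ∧ Φ i = d} with hT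
  have hTA : ∀ d ∈ T, A d.1.1 = d.1.2 ∨ A d.2.1 = d.2.2 := by
    rintro d ⟨i, hi, rfl⟩
    exact hA i hi
  have hno : ¬ ∃ A' : Fin n → Bool, (∀ d ∈ T, A' d.1.1 = d.1.2 ∨ A' d.2.1 = d.2.2) ∧
      (A' a.1 = a.2 ∨ A' b.1 = b.2) := by
    rintro ⟨A', h1, h2⟩
    refine hj ⟨A', fun i hi => ?_⟩
    rcases Nat.lt_succ_iff_lt_or_eq.mp hi with h | h
    · exact h1 _ ⟨i, h, rfl⟩
    · have : i = ⟨j, hjm⟩ := Fin.ext h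
      rw [this, hab]
      exact h2
  have ra := reach_neg hTA (a := a) (fun ⟨A', h1, h2⟩ => hno ⟨A', h1, Or.inl h2⟩)
  have rb := reach_neg hTA (a := b) (fun ⟨A', h1, h2⟩ => hno ⟨A', h1, Or.inr h2⟩)
  have hnR : ¬ RT T (lneg a) b := by
    rintro ⟨d, hd, he⟩
    rw [mem_Ev, lneg_lneg] at he
    have := hTA d hd
    refine hno ⟨A, hTA, ?_⟩
    rcases he with rfl | rfl
    · exact this
    · exact this.symm
  have hR : ∀ x y, RT T x y → ∃ j, Φ j ∈ Ev x y := by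
    rintro x y ⟨d, ⟨i, _, rfl⟩, h⟩
    exact ⟨i, h⟩
  have hRc : ∃ j, Φ j ∈ Ev (lneg a) b := ⟨⟨j, hjm⟩, by rw [hab]; simp [mem_Ev]⟩
  obtain ⟨w, v, w1, w2, -, w4⟩ := first_repeat ra ∅ (by simp) (Or.inr rfl)
  simp only [Finset.notMem_empty, false_or] at w4
  -- reversed chain
  have w1' : List.IsChain (RT T) (lneg v :: (((a :: w).map lneg).reverse)) := by
    have e : (lneg v :: (((a :: w).map lneg).reverse)) = ((a :: (w ++ [v])).map lneg).reverse := by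
      simp
    rw [e, List.isChain_reverse, List.isChain_map]
    exact w1.imp fun x y h => RT_skew h
  have w1'' := w1'.imp hR
  have hlast : ((a :: w).map lneg).reverse.getLast? = some (lneg a) := by simp
  set W := ((a :: w).map lneg).reverse with hW
  have hWf : W.map Prod.fst = ((a :: w).map Prod.fst).reverse := by
    rw [hW, List.map_reverse, List.map_map]
    rfl
  have hWn : (W.map Prod.fst).Nodup := by rw [hWf, List.nodup_reverse]; exact w2
  have hv : (lneg v).1 ∈ W.map Prod.fst := by rw [hWf, List.mem_reverse]; exact w4
  have hWne : W ≠ [] := by simp [hW]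
  by_cases hb : b.1 ∈ W.map Prod.fst
  · refine ⟨W, lneg v, b, hWn, hv, hb, ?_, ?_⟩
    · rw [← List.cons_append, List.isChain_append]
      refine ⟨w1'', by simp, ?_⟩
      intro x hx y hy
      simp only [List.head?_cons, Option.mem_def, Option.some.injEq] at hy
      rw [List.getLast?_cons, hlast] at hx
      simp only [Option.getD_some, Option.mem_def, Option.some.injEq] at hx
      subst hx hy
      exact hRc
    · rintro ⟨h1, h2⟩
      rw [hlast, Option.some.injEq] at h1
      obtain ⟨x, W', hx⟩ := List.exists_cons_of_ne_nil hWne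
      rw [hx] at h2 w1'
      simp at h2
      subst h2
      rw [List.isChain_cons_cons, ← h1] at w1'
      exact hnR w1'.1
  · obtain ⟨z, v', z1, z2, z3, z4⟩ := first_repeat rb (W.map Prod.fst).toFinset
      (by simpa using hb) (Or.inr rfl)
    refine ⟨W ++ (b :: z), lneg v, v', ?_, ?_, ?_, ?_, ?_⟩
    · rw [List.map_append, List.nodup_append']
      refine ⟨hWn, z2, ?_⟩
      intro u hu hu'
      obtain ⟨q, hq, rfl⟩ := List.mem_map.mp hu'
      exact z3 q hq (by rw [List.mem_toFinset]; exact hu)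
    · rw [List.map_append]; exact List.mem_append_left _ hv
    · rw [List.map_append, List.mem_append]
      rcases z4 with h | h
      · left; rwa [List.mem_toFinset] at h
      · right; exact h
    · rw [List.append_assoc, ← List.cons_append, List.isChain_append]
      refine ⟨w1'', z1.imp hR, ?_⟩
      intro x hx y hy
      simp only [List.cons_append, List.head?_cons, Option.mem_def, Option.some.injEq] at hy
      rw [List.getLast?_cons, hlast] at hx
      simp only [Option.getD_some, Option.mem_def, Option.some.injEq] at hx
      subst hx hy
      exact hRc
    · rintro ⟨h1, -⟩
      rw [List.getLast?_append_of_ne_nil _ (by simp)] at h1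
      have := List.mem_of_getLast? h1
      exact z3 _ this (by rw [List.mem_toFinset]; exact hv)

end PartOne

section PartOneB

/-- source of edge -/
def srcE {n K : ℕ} (Y : Fin K → Fin n × Bool) (y0 : Fin n × Bool) (i : Fin (K+1)) : Fin n × Bool :=
  (Fin.cons y0 Y : Fin (K+1) → Fin n × Bool) i
/-- target of edge -/
def tgtE {n K : ℕ} (Y : Fin K → Fin n × Bool) (y1 : Fin n × Bool) (i : Fin (K+1)) : Fin n × Bool :=
  (Fin.snoc Y y1 : Fin (K+1) → Fin n × Bool) i

lemma srcE_get {n : ℕ} (L : List (Fin n × Bool)) (y0 y1 : Fin n × Bool) (i : Fin (L.length+1)) :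
    srcE L.get y0 i = (y0 :: (L ++ [y1]))[i.1]'(by simp) := by
  unfold srcE
  refine Fin.cases ?_ (fun i => ?_) i
  · simp
  · simp

lemma tgtE_get {n : ℕ} (L : List (Fin n × Bool)) (y0 y1 : Fin n × Bool) (i : Fin (L.length+1)) :
    tgtE L.get y1 i = (y0 :: (L ++ [y1]))[i.1+1]'(by simp; omega) := by
  unfold tgtE
  refine Fin.lastCases ?_ (fun i => ?_) i
  · simp
  · simp

/-- edges pairwise disjoint -/
def validB {n K : ℕ} (Y : Fin K → Fin n × Bool) (y0 y1 : Fin n × Bool) : Prop :=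
  ∀ i j, i ≠ j → Disjoint (Ev (srcE Y y0 i) (tgtE Y y1 i)) (Ev (srcE Y y0 j) (tgtE Y y1 j))

lemma validB_of {n K : ℕ} {Y : Fin K → Fin n × Bool} {y0 y1 : Fin n × Bool}
    (hY : Function.Injective (fun i => (Y i).1))
    (hne : ∀ h : 0 < K, ¬ (Y ⟨K - 1, by omega⟩ = y0 ∧ Y ⟨0, h⟩ = y1)) : validB Y y0 y1 := by
  have key : ∀ i j : Fin (K+1), i < j →
      Disjoint (Ev (srcE Y y0 i) (tgtE Y y1 i)) (Ev (srcE Y y0 j) (tgtE Y y1 j)) := by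
    intro i j hij
    have hij' : i.1 < j.1 := hij
    have hjK : j.1 ≤ K := by omega
    have ti : tgtE Y y1 i = Y ⟨i.1, by omega⟩ := by
      exact Fin.snoc_castSucc (α := fun _ => Fin n × Bool) y1 Y ⟨i.1, by omega⟩
    have sj : srcE Y y0 j = Y ⟨j.1 - 1, by omega⟩ := by
      have : j = Fin.succ ⟨j.1 - 1, by omega⟩ := by ext; simp; omega
      conv_lhs => rw [this, srcE, Fin.cons_succ]
    apply Ev_disj
    rintro (⟨h1, h2⟩ | ⟨h1, h2⟩)
    · by_cases hi : i.1 = 0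
      · have hi0 : i = 0 := Fin.ext hi
        by_cases hj : j.1 = K
        · have hjl : j = Fin.last K := Fin.ext hj
          have tj : tgtE Y y1 j = y1 := by rw [hjl, tgtE, Fin.snoc_last]
          have si : srcE Y y0 i = y0 := by rw [hi0, srcE, Fin.cons_zero]
          refine hne (by omega) ⟨?_, ?_⟩
          · rw [← si, h1, sj]; congr 1; ext; simp [hj]
          · rw [← tj, ← h2, ti]; congr 1; ext; simp [hi]
        · have tj : tgtE Y y1 j = Y ⟨j.1, by omega⟩ := by
            exact Fin.snoc_castSucc (α := fun _ => Fin n × Bool) y1 Y ⟨j.1, by omega⟩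
          rw [ti, tj] at h2
          have := hY (congrArg Prod.fst h2)
          simp at this
          omega
      · have si : srcE Y y0 i = Y ⟨i.1 - 1, by omega⟩ := by
          have : i = Fin.succ ⟨i.1 - 1, by omega⟩ := by ext; simp; omega
          conv_lhs => rw [this, srcE, Fin.cons_succ]
        rw [si, sj] at h1
        have := hY (congrArg Prod.fst h1)
        simp at this
        omega
    · rw [ti, sj] at h2
      have h3 := congrArg Prod.fst h2
      rw [lneg_fst] at h3
      rw [hY h3] at h2
      exact lneg_ne _ h2.symm
  intro i j hij
  rcases lt_or_gt_of_ne hij with h | h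
  · exact key i j h
  · exact (key j i h).symm

lemma bicycle_fin {n m : ℕ} {Φ : Fin m → (Fin n × Bool) × (Fin n × Bool)} (hΦ : ¬ Sat2 Φ) :
    ∃ K ∈ Finset.range (n+1), ∃ (Y : Fin K → Fin n × Bool) (s t : Fin K × Bool),
      validB Y ((Y s.1).1, s.2) ((Y t.1).1, t.2) ∧
      ∀ i, ∃ j, Φ j ∈ Ev (srcE Y ((Y s.1).1, s.2) i) (tgtE Y ((Y t.1).1, t.2) i) := by
  obtain ⟨L, y0, y1, h1, h2, h3, h4, h5⟩ := bicycle hΦ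
  refine ⟨L.length, ?_, L.get, ?_⟩
  · have := h1.length_le_card
    simp at this
    rw [Finset.mem_range]; omega
  obtain ⟨u, hu, hu'⟩ := List.mem_map.mp h2
  obtain ⟨v, hv, hv'⟩ := List.mem_map.mp h3
  obtain ⟨k, rfl⟩ := List.get_of_mem hu
  obtain ⟨l, rfl⟩ := List.get_of_mem hv
  refine ⟨(k, y0.2), (l, y1.2), ?_⟩
  have e0 : ((L.get k).1, y0.2) = y0 := by rw [hu']
  have e1 : ((L.get l).1, y1.2) = y1 := by rw [hv']
  simp only [e0, e1]
  constructor
  · apply validB_of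
    · intro i j hij
      have := List.nodup_iff_injective_get.mp h1 (a₁ := ⟨i.1, by simp⟩) (a₂ := ⟨j.1, by simp⟩)
        (by simpa using hij)
      ext
      simpa using this
    · intro h
      rintro ⟨g1, g2⟩
      apply h5
      constructor
      · rw [List.getLast?_eq_getElem?, ← g1]; simp
      · rw [List.head?_eq_getElem?, ← g2]; simp
  · intro i
    rw [srcE_get L y0 y1, tgtE_get L y0 y1]
    exact List.isChain_iff_getElem.mp h4 i.1 (by simp; omega)

lemma sum_prod_sq {n K : ℕ} (p : ℕ → ℝ) :
    ∑ Y : Fin K → Fin n × Bool, ∏ i, p (Y i).1 ^ 2 = (2 * ∑ i ∈ Finset.range n, p i ^ 2) ^ K := by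
  have := Finset.prod_univ_sum (fun _ : Fin K => (Finset.univ : Finset (Fin n × Bool)))
    (fun _ x => p x.1 ^ 2)
  rw [Fintype.piFinset_univ] at this
  rw [← this]
  simp [Fintype.sum_prod_type, Finset.sum_range, Finset.mul_sum]

lemma partOne {n m : ℕ} {p : ℕ → ℝ} (hg : GoodP n p) (hs : ∀ i : Fin n, p i ≤ p 0) {r : ℝ}
    (hr0 : 0 ≤ r) (hr1 : r < 1)
    (hr : m * (1 - ∑ i ∈ Finset.range n, p i ^ 2)⁻¹ * (∑ i ∈ Finset.range n, p i ^ 2) ≤ r) :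
    1 - probSat2 n m p ≤
      (∑' K : ℕ, (K:ℝ)^2 * r ^ K) * (2 * p 0 ^ 2 / ∑ i ∈ Finset.range n, p i ^ 2) := by
  have hn : 0 < n := by
    rcases Nat.eq_zero_or_pos n with rfl | h
    · have := hg.sum1; simp at this
    · exact h
  set S := ∑ i ∈ Finset.range n, p i ^ 2 with hS
  have hS0 : 0 < S := by
    rw [hS, Finset.sum_range]
    exact Finset.sum_pos (fun i _ => pow_pos (hg.pos i) 2) ⟨⟨0, hn⟩, Finset.mem_univ _⟩
  have hC : 0 < (1 - S)⁻¹ := inv_pos.mpr (by linarith [hg.lt1])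
  set C := (1 - S)⁻¹ with hCd
  set w := clauseProb2 n p with hw
  have hw0 := clauseProb_nonneg hg
  have hw1 := clauseProb_sum hg
  rw [probSat_compl hg, sub_sub_cancel]
  set V : (K : ℕ) → Finset ((Fin K → Fin n × Bool) × ((Fin K × Bool) × (Fin K × Bool))) :=
    fun K => Finset.univ.filter fun q =>
      validB q.1 ((q.1 q.2.1.1).1, q.2.1.2) ((q.1 q.2.2.1).1, q.2.2.2) with hV
  set E : (K : ℕ) → ((Fin K → Fin n × Bool) × ((Fin K × Bool) × (Fin K × Bool))) → Fin (K+1) →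
    Finset ((Fin n × Bool) × (Fin n × Bool)) := fun K q i =>
      Ev (srcE q.1 ((q.1 q.2.1.1).1, q.2.1.2) i) (tgtE q.1 ((q.1 q.2.2.1).1, q.2.2.2) i) with hE
  have step1 : Ex m w (fun Φ => if Sat2 Φ then 0 else 1) ≤
      Ex m w (fun Φ => ∑ K ∈ Finset.range (n+1), ∑ q ∈ V K, ∏ i, cnt (E K q i) Φ) := by
    refine Ex_mono hw0 fun Φ _ => ?_
    have hnn : ∀ K, ∀ q, 0 ≤ ∏ i, cnt (E K q i) Φ := fun K q =>
      Finset.prod_nonneg fun i _ => cnt_nonneg _ _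
    split_ifs with h
    · exact Finset.sum_nonneg fun K _ => Finset.sum_nonneg fun q _ => hnn K q
    · obtain ⟨K, hK, Y, s, t, h1, h2⟩ := bicycle_fin h
      have a1 : (1:ℝ) ≤ ∏ i, cnt (E K (Y, s, t) i) Φ := by
        have := Finset.prod_le_prod (s := (Finset.univ : Finset (Fin (K+1)))) (f := fun _ => (1:ℝ))
          (g := fun i => cnt (E K (Y, s, t) i) Φ) (fun _ _ => zero_le_one)
          (fun i _ => one_le_cnt (h2 i))
        simpa using this
      have a2 : ∏ i, cnt (E K (Y, s, t) i) Φ ≤ ∑ q ∈ V K, ∏ i, cnt (E K q i) Φ :=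
        Finset.single_le_sum (f := fun q => ∏ i, cnt (E K q i) Φ) (fun q _ => hnn K q)
          (by simp [hV, h1])
      have a3 := Finset.single_le_sum (f := fun K => ∑ q ∈ V K, ∏ i, cnt (E K q i) Φ)
          (fun K _ => Finset.sum_nonneg fun q _ => hnn K q) hK
      exact a1.trans (a2.trans a3)
  refine step1.trans ?_
  rw [Ex_sum]
  have step2 : ∀ K, Ex m w (fun Φ => ∑ q ∈ V K, ∏ i, cnt (E K q i) Φ) ≤
      ((K:ℝ)^2 * r ^ K) * (2 * p 0 ^ 2 / S) := by
    intro K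
    rw [Ex_sum]
    calc ∑ q ∈ V K, Ex m w (fun Φ => ∏ i, cnt (E K q i) Φ)
        ≤ ∑ q ∈ V K, (m * (C / 2)) ^ (K+1) * p 0 ^ 2 * ∏ i, p (q.1 i).1 ^ 2 := by
          refine Finset.sum_le_sum fun q hq => ?_
          have hv : validB q.1 ((q.1 q.2.1.1).1, q.2.1.2) ((q.1 q.2.2.1).1, q.2.2.2) := by
            simpa [hV] using hq
          refine (first_moment_le hw0 hw1 (E K q) hv).trans ?_
          calc ∏ i, (m * wt w (E K q i)) ≤ ∏ i : Fin (K+1), ((m * (C/2)) *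
                (p (srcE q.1 ((q.1 q.2.1.1).1, q.2.1.2) i).1 *
                  p (tgtE q.1 ((q.1 q.2.2.1).1, q.2.2.2) i).1)) := by
                refine Finset.prod_le_prod
                  (fun i _ => mul_nonneg (Nat.cast_nonneg _) (wt_nonneg hw0 _)) fun i _ => ?_
                have := wt_Ev_le hg (srcE q.1 ((q.1 q.2.1.1).1, q.2.1.2) i)
                  (tgtE q.1 ((q.1 q.2.2.1).1, q.2.2.2) i)
                have := mul_le_mul_of_nonneg_left this (Nat.cast_nonneg (α := ℝ) m)
                refine this.trans (le_of_eq ?_)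
                rw [hCd, hS]; ring
            _ = (m * (C / 2)) ^ (K+1) * (p (q.1 q.2.1.1).1 * p (q.1 q.2.2.1).1)
                  * ∏ i, p (q.1 i).1 ^ 2 := by
                rw [Finset.prod_mul_distrib, Finset.prod_const,
                  Finset.prod_mul_distrib (f := fun i => p (srcE q.1 ((q.1 q.2.1.1).1, q.2.1.2) i).1)]
                rw [Fin.prod_univ_succ (fun i => p (srcE q.1 ((q.1 q.2.1.1).1, q.2.1.2) i).1),
                  Fin.prod_univ_castSucc (fun i => p (tgtE q.1 ((q.1 q.2.2.1).1, q.2.2.2) i).1)]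
                simp only [srcE, tgtE, Fin.cons_zero, Fin.cons_succ, Fin.snoc_castSucc,
                  Fin.snoc_last, Finset.prod_const, Finset.card_univ, Fintype.card_fin,
                  Finset.prod_pow]
                ring
            _ ≤ _ := by
                have h1 := hs (q.1 q.2.1.1).1
                have h2 := hs (q.1 q.2.2.1).1
                have h3 := hg.pos (q.1 q.2.1.1).1
                have h4 := hg.pos (q.1 q.2.2.1).1
                have h5 : p (q.1 q.2.1.1).1 * p (q.1 q.2.2.1).1 ≤ p 0 ^ 2 := by
                  rw [sq]; exact mul_le_mul h1 h2 h4.le (h3.le.trans h1)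
                refine mul_le_mul_of_nonneg_right (mul_le_mul_of_nonneg_left h5 (by positivity))
                  (Finset.prod_nonneg fun i _ => by positivity)
      _ ≤ ∑ q : (Fin K → Fin n × Bool) × ((Fin K × Bool) × (Fin K × Bool)),
            (m * (C / 2)) ^ (K+1) * p 0 ^ 2 * ∏ i, p (q.1 i).1 ^ 2 := by
          refine Finset.sum_le_sum_of_subset_of_nonneg (Finset.subset_univ _) fun q _ _ => ?_
          exact mul_nonneg (by positivity) (Finset.prod_nonneg fun i _ => by positivity)
      _ = (m * (C / 2)) ^ (K+1) * p 0 ^ 2 * ((2 * K) ^ 2 * (2 * S) ^ K) := by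
          rw [← Finset.mul_sum, Fintype.sum_prod_type, hS, ← sum_prod_sq]
          simp only [Finset.sum_const, Finset.card_univ, Fintype.card_prod, Fintype.card_fin,
            Fintype.card_bool, nsmul_eq_mul]
          rw [← Finset.mul_sum]
          push_cast
          ring
      _ = ((K:ℝ)^2 * (m * C * S) ^ (K+1)) * (2 * p 0 ^ 2 / S) := by
          have : (m * C * S) ^ (K+1) = (m * (C / 2)) ^ (K+1) * (2 * S)^K * (2 * S) := by
            rw [mul_assoc ((m * (C / 2)) ^ (K+1)), ← pow_succ, ← mul_pow]; congr 1; ring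
          rw [this]
          field_simp
          try ring
      _ ≤ _ := by
          have h0 : 0 ≤ m * C * S := by positivity
          have : (m * C * S) ^ (K+1) ≤ r ^ K := by
            calc (m * C * S) ^ (K+1) ≤ r ^ (K+1) := pow_le_pow_left₀ h0 hr _
              _ ≤ r ^ K := pow_le_pow_of_le_one hr0 hr1.le (by omega)
          gcongr
  refine (Finset.sum_le_sum fun K _ => step2 K).trans ?_
  rw [← Finset.sum_mul]
  refine mul_le_mul_of_nonneg_right ?_ (by positivity)
  refine Summable.sum_le_tsum _ (fun K _ => by positivity) ?_
  exact summable_pow_mul_geometric_of_norm_lt_one 2 (by rw [Real.norm_of_nonneg hr0]; exact hr1)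

end PartOneB

section Walk

/-- walk sums -/
noncomputable def wk {X Λ : Type*} [Fintype Λ] (e : Λ → X) (M : X → X → ℝ) : ℕ → X → X → ℝ
  | 0, y, z => M y z
  | k+1, y, z => ∑ x : Λ, M y (e x) * wk e M k (e x) z

lemma wk_eq {n : ℕ} {Λ : Type*} [Fintype Λ] (e : Λ → Fin n × Bool)
    (M : Fin n × Bool → Fin n × Bool → ℝ) (z : Fin n × Bool) :
    ∀ (k : ℕ) (y : Fin n × Bool),
    ∑ f : Fin k → Λ, ∏ i, M (srcE (fun j => e (f j)) y i) (tgtE (fun j => e (f j)) z i)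
      = wk e M k y z := by
  intro k
  induction k with
  | zero =>
    intro y
    simp [wk, srcE, tgtE, Fin.snoc]
  | succ k ih =>
    intro y
    rw [← (Fin.consEquiv (fun _ : Fin (k+1) => Λ)).sum_comp, Fintype.sum_prod_type, wk]
    refine Finset.sum_congr rfl fun x _ => ?_
    rw [← ih, Finset.mul_sum]
    refine Finset.sum_congr rfl fun f _ => ?_
    rw [Fin.prod_univ_succ]
    have e1 : (fun j => e ((Fin.consEquiv (fun _ : Fin (k+1) => Λ)) (x, f) j)) =
        (Fin.cons (e x) (fun j => e (f j)) : Fin (k+1) → Fin n × Bool) := by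
      funext j
      refine Fin.cases ?_ (fun j => ?_) j <;> simp [Fin.consEquiv]
    rw [e1]
    have s0 : srcE (Fin.cons (e x) (fun j => e (f j)) : Fin (k+1) → Fin n × Bool) y 0 = y := rfl
    have t0 : tgtE (Fin.cons (e x) (fun j => e (f j)) : Fin (k+1) → Fin n × Bool) z 0 = e x := by
      unfold tgtE
      rw [← Fin.cons_snoc_eq_snoc_cons]
      rfl
    have s1 : ∀ i : Fin (k+1), srcE (Fin.cons (e x) (fun j => e (f j)) : Fin (k+1) → Fin n × Bool)
        y i.succ = srcE (fun j => e (f j)) (e x) i := fun i => rfl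
    have t1 : ∀ i : Fin (k+1), tgtE (Fin.cons (e x) (fun j => e (f j)) : Fin (k+1) → Fin n × Bool)
        z i.succ = tgtE (fun j => e (f j)) z i := by
      intro i
      unfold tgtE
      rw [← Fin.cons_snoc_eq_snoc_cons]
      rfl
    rw [s0, t0]
    simp_rw [s1, t1]

lemma wk_nonneg {X Λ : Type*} [Fintype Λ] (e : Λ → X) (M : X → X → ℝ) (hM : ∀ y z, 0 ≤ M y z) :
    ∀ k y z, 0 ≤ wk e M k y z := by
  intro k
  induction k with
  | zero => intro y z; exact hM y z
  | succ k ih => intro y z; exact Finset.sum_nonneg fun x _ => mul_nonneg (hM _ _) (ih _ _)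

set_option maxHeartbeats 1000000 in
/-- The main walk estimate. -/
lemma wk_bound {X Λ : Type*} [Fintype Λ] (e : Λ → X) (B : X → X → ℝ) (ξ : X → ℝ)
    {μ κ θ Kc cV J0 r0 : ℝ} (V : Finset Λ) (hB : ∀ y z, 0 ≤ B y z) (hξ : ∀ y, 0 ≤ ξ y)
    (hκ : ∀ x, ξ (e x) ≤ κ) (hκ0 : 0 ≤ κ) (hμ : 0 ≤ μ) (hKc : 0 ≤ Kc)
    (hθ : θ = ∑ x, ξ (e x) ^ 2)
    (hV : (V.card : ℝ) ≤ cV) (hrow : ∀ x, ∑ z, B (e x) (e z) ≤ if x ∈ V then 1 else 0)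
    (hcol : ∀ z, ∑ x, B (e x) (e z) ≤ 1)
    (hK : μ * θ * Kc = 1 + Kc) {t h : X} (hJ0 : ∑ x, B (e x) t ≤ J0) (hr0 : ∑ x, B h (e x) ≤ r0)
    (s : ℕ) (hs : 1 ≤ s) :
    wk e (fun y z => μ * ξ y * ξ z + B y z) s h t ≤
      (μ * (θ + cV * Kc * κ ^ 2)) ^ s * μ * (ξ t + J0 * Kc * κ) * (ξ h + r0 * Kc * κ)
        + μ * ξ h * κ * J0 + r0 * J0 := by
  set M : X → X → ℝ := fun y z => μ * ξ y * ξ z + B y z with hM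
  set ν := μ * (θ + cV * Kc * κ ^ 2) with hν
  set v : Λ → ℝ := fun x => ξ (e x) + Kc * κ * (if x ∈ V then 1 else 0) with hv
  have hcV : 0 ≤ cV := le_trans (Nat.cast_nonneg _) hV
  have hθ0 : 0 ≤ θ := by rw [hθ]; exact Finset.sum_nonneg fun x _ => sq_nonneg _
  have hJ00 : 0 ≤ J0 := le_trans (Finset.sum_nonneg fun x _ => hB _ _) hJ0
  have hr00 : 0 ≤ r0 := le_trans (Finset.sum_nonneg fun x _ => hB _ _) hr0
  have hv0 : ∀ x, 0 ≤ v x := fun x => by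
    have := hξ (e x)
    simp only [hv]; split_ifs <;> positivity
  have hξv : ∀ x, ξ (e x) ≤ v x := fun x => by
    simp only [hv]
    have : 0 ≤ Kc * κ * (if x ∈ V then (1:ℝ) else 0) := by split_ifs <;> positivity
    linarith
  have hvκ : ∀ x, v x ≤ κ * (1 + Kc) := fun x => by
    have := hκ x
    have h2 : 0 ≤ Kc * κ := by positivity
    simp only [hv]; split_ifs <;> nlinarith
  have hνν : μ * θ ≤ ν := by
    rw [hν]
    have : 0 ≤ cV * Kc * κ ^ 2 := by positivity
    nlinarith
  have hν0 : 0 ≤ ν := le_trans (by positivity) hνν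
  have hνK : 1 + Kc ≤ ν * Kc := by rw [← hK]; exact mul_le_mul_of_nonneg_right hνν hKc
  -- sum ξ v
  have hξv2 : ∑ x, ξ (e x) * v x ≤ θ + cV * Kc * κ ^ 2 := by
    have e1 : ∑ x, ξ (e x) * v x = θ + Kc * κ * ∑ x ∈ V, ξ (e x) := by
      have e0 : ∑ x ∈ V, ξ (e x) = ∑ x, if x ∈ V then ξ (e x) else 0 := by
        rw [Finset.sum_ite_mem, Finset.univ_inter]
      rw [hθ, e0, Finset.mul_sum, ← Finset.sum_add_distrib]
      refine Finset.sum_congr rfl fun x _ => ?_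
      simp only [hv]; split_ifs <;> ring
    have e2 : ∑ x ∈ V, ξ (e x) ≤ cV * κ := by
      calc ∑ x ∈ V, ξ (e x) ≤ V.card • κ := Finset.sum_le_card_nsmul _ _ _ fun x _ => hκ x
        _ = V.card * κ := by simp
        _ ≤ cV * κ := mul_le_mul_of_nonneg_right hV hκ0
    rw [e1]
    have := mul_le_mul_of_nonneg_left e2 (mul_nonneg hKc hκ0)
    nlinarith
  have hMv : ∀ y, ∑ z, M y (e z) * v z ≤ ν * ξ y + (∑ z, B y (e z)) * (κ * (1 + Kc)) := by
    intro y
    have e1 : ∑ z, M y (e z) * v z = μ * ξ y * ∑ z, ξ (e z) * v z + ∑ z, B y (e z) * v z := by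
      rw [Finset.mul_sum, ← Finset.sum_add_distrib]
      refine Finset.sum_congr rfl fun z _ => ?_
      simp only [hM]; ring
    rw [e1, Finset.sum_mul]
    refine add_le_add ?_ (Finset.sum_le_sum fun z _ => mul_le_mul_of_nonneg_left (hvκ z) (hB _ _))
    have := mul_le_mul_of_nonneg_left hξv2 (mul_nonneg hμ (hξ y))
    rw [hν]; nlinarith
  have hMvΛ : ∀ x, ∑ z, M (e x) (e z) * v z ≤ ν * v x := by
    intro x
    refine (hMv _).trans ?_
    have h1 := mul_le_mul_of_nonneg_right (hrow x) (by positivity : 0 ≤ κ * (1 + Kc))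
    have h2 := mul_le_mul_of_nonneg_left hνK hκ0
    have e1 : ν * v x = ν * ξ (e x) + ν * Kc * κ * (if x ∈ V then 1 else 0) := by
      simp only [hv]; ring
    rw [e1]
    split_ifs at h1 ⊢ <;> nlinarith
  -- main induction
  have main : ∀ k, ∃ J : Λ → ℝ, (∀ x, 0 ≤ J x) ∧ (∑ x, J x ≤ J0) ∧
      ∀ x, wk e M k (e x) t ≤ J x + (ν ^ k * μ * (ξ t + J0 * Kc * κ) - μ * J0 * Kc * κ) * v x := by
    intro k
    induction k with
    | zero =>
      refine ⟨fun x => B (e x) t, fun x => hB _ _, hJ0, fun x => ?_⟩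
      simp only [wk, hM, pow_zero, one_mul]
      have := mul_le_mul_of_nonneg_left (hξv x) (mul_nonneg hμ (hξ t))
      nlinarith
    | succ k ih =>
      obtain ⟨J, hJ1, hJ2, hJ3⟩ := ih
      refine ⟨fun x => ∑ z, B (e x) (e z) * J z, fun x => Finset.sum_nonneg fun z _ =>
        mul_nonneg (hB _ _) (hJ1 z), ?_, fun x => ?_⟩
      · rw [Finset.sum_comm]
        refine le_trans (Finset.sum_le_sum fun z _ => ?_) hJ2
        rw [← Finset.sum_mul]
        have := mul_le_mul_of_nonneg_right (hcol z) (hJ1 z)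
        linarith
      · set Ek := ν ^ k * μ * (ξ t + J0 * Kc * κ) - μ * J0 * Kc * κ with hEk
        have hM0 : ∀ y z, 0 ≤ M y z := fun y z => by
          have := hξ y; have := hξ z; have := hB y z
          simp only [hM]; positivity
        have hEk0 : 0 ≤ Ek := by
          rw [hEk]
          have hν1 : 1 ≤ ν := by
            by_contra hcon
            push Not at hcon
            nlinarith
          have : 1 ≤ ν ^ k := one_le_pow₀ hν1
          have h3 : 0 ≤ μ * ξ t := mul_nonneg hμ (hξ t)
          have h4 : 0 ≤ μ * J0 * Kc * κ := by positivity
          nlinarith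
        have c1 : wk e M (k+1) (e x) t ≤ ∑ z, M (e x) (e z) * (J z + Ek * v z) :=
          Finset.sum_le_sum fun z _ => mul_le_mul_of_nonneg_left (hJ3 z) (hM0 _ _)
        have c2 : ∑ z, M (e x) (e z) * (J z + Ek * v z) =
            ∑ z, B (e x) (e z) * J z + μ * ξ (e x) * ∑ z, ξ (e z) * J z
              + Ek * ∑ z, M (e x) (e z) * v z := by
          rw [Finset.mul_sum, Finset.mul_sum, ← Finset.sum_add_distrib, ← Finset.sum_add_distrib]
          refine Finset.sum_congr rfl fun z _ => ?_
          simp only [hM]; ring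
        have c3 : ∑ z, ξ (e z) * J z ≤ κ * J0 := by
          calc ∑ z, ξ (e z) * J z ≤ ∑ z, κ * J z :=
                Finset.sum_le_sum fun z _ => mul_le_mul_of_nonneg_right (hκ z) (hJ1 z)
            _ = κ * ∑ z, J z := by rw [Finset.mul_sum]
            _ ≤ κ * J0 := mul_le_mul_of_nonneg_left hJ2 hκ0
        have c4 : μ * ξ (e x) * ∑ z, ξ (e z) * J z ≤ μ * κ * J0 * v x := by
          calc μ * ξ (e x) * ∑ z, ξ (e z) * J z ≤ μ * ξ (e x) * (κ * J0) :=
                mul_le_mul_of_nonneg_left c3 (mul_nonneg hμ (hξ _))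
            _ = μ * κ * J0 * ξ (e x) := by ring
            _ ≤ _ := mul_le_mul_of_nonneg_left (hξv x) (by positivity)
        have c5 := mul_le_mul_of_nonneg_left (hMvΛ x) hEk0
        have c6 : (μ * κ * J0 + Ek * ν) * v x ≤
            (ν ^ (k+1) * μ * (ξ t + J0 * Kc * κ) - μ * J0 * Kc * κ) * v x := by
          refine mul_le_mul_of_nonneg_right ?_ (hv0 x)
          rw [hEk, pow_succ]
          have := mul_le_mul_of_nonneg_left hνK (by positivity : 0 ≤ μ * κ * J0)
          nlinarith
        rw [add_mul] at c6
        rw [← mul_assoc] at c5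
        rw [c2] at c1
        show _ ≤ (∑ z, B (e x) (e z) * J z) + _
        linarith
  obtain ⟨k, rfl⟩ : ∃ k, s = k + 1 := ⟨s - 1, by omega⟩
  obtain ⟨J, hJ1, hJ2, hJ3⟩ := main k
  set Q := ξ t + J0 * Kc * κ with hQ
  have hQ0 : 0 ≤ Q := by have := hξ t; positivity
  set E := ν ^ k * μ * Q with hE
  have hE0 : 0 ≤ E := by positivity
  have hM0 : ∀ y z, 0 ≤ M y z := fun y z => by
    have := hξ y; have := hξ z; have := hB y z
    simp only [hM]; positivity
  have c1 : wk e M (k+1) h t ≤ ∑ z, M h (e z) * (J z + E * v z) := by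
    refine Finset.sum_le_sum fun z _ => mul_le_mul_of_nonneg_left ((hJ3 z).trans ?_) (hM0 _ _)
    have : 0 ≤ μ * J0 * Kc * κ * v z := mul_nonneg (by positivity) (hv0 z)
    nlinarith
  have c2 : ∑ z, M h (e z) * (J z + E * v z) =
      ∑ z, B h (e z) * J z + μ * ξ h * ∑ z, ξ (e z) * J z + E * ∑ z, M h (e z) * v z := by
    rw [Finset.mul_sum, Finset.mul_sum, ← Finset.sum_add_distrib, ← Finset.sum_add_distrib]
    refine Finset.sum_congr rfl fun z _ => ?_
    simp only [hM]; ring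
  have c3 : ∑ z, ξ (e z) * J z ≤ κ * J0 := by
    calc ∑ z, ξ (e z) * J z ≤ ∑ z, κ * J z :=
          Finset.sum_le_sum fun z _ => mul_le_mul_of_nonneg_right (hκ z) (hJ1 z)
      _ = κ * ∑ z, J z := by rw [Finset.mul_sum]
      _ ≤ κ * J0 := mul_le_mul_of_nonneg_left hJ2 hκ0
  have c4 : μ * ξ h * ∑ z, ξ (e z) * J z ≤ μ * ξ h * (κ * J0) :=
    mul_le_mul_of_nonneg_left c3 (mul_nonneg hμ (hξ _))
  have c5 : ∑ z, B h (e z) * J z ≤ r0 * J0 := by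
    calc ∑ z, B h (e z) * J z ≤ ∑ z, B h (e z) * J0 :=
          Finset.sum_le_sum fun z _ => mul_le_mul_of_nonneg_left
            ((Finset.single_le_sum (fun z _ => hJ1 z) (Finset.mem_univ z)).trans hJ2) (hB _ _)
      _ = (∑ z, B h (e z)) * J0 := by rw [Finset.sum_mul]
      _ ≤ _ := mul_le_mul_of_nonneg_right hr0 hJ00
  have c6 : ∑ z, M h (e z) * v z ≤ ν * (ξ h + r0 * Kc * κ) := by
    refine (hMv h).trans ?_
    have h1 := mul_le_mul_of_nonneg_right hr0 (by positivity : 0 ≤ κ * (1 + Kc))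
    have h2 := mul_le_mul_of_nonneg_left hνK (by positivity : 0 ≤ r0 * κ)
    nlinarith
  have c7 := mul_le_mul_of_nonneg_left c6 hE0
  have c8 : E * (ν * (ξ h + r0 * Kc * κ)) = ν ^ (k+1) * μ * Q * (ξ h + r0 * Kc * κ) := by
    rw [hE, pow_succ]; ring
  rw [c2] at c1
  rw [c8] at c7
  linarith

end Walk

section Snake

lemma distinct_sum {Λ T : Type*} [Fintype Λ] (var : Λ → T) (g : Λ → ℝ)
    (hg : ∀ x, 0 ≤ g x) {c0 b : ℝ} (hc : ∀ t, ∑ x, (if var x = t then g x else 0) ≤ c0)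
    (hc0 : 0 ≤ c0) (hb : b ≤ ∑ x, g x) :
    ∀ N : ℕ, N * c0 ≤ b → ((∑ x, g x) - b) ^ N ≤
      ∑ f : Fin N → Λ, if Function.Injective (fun i => var (f i)) then ∏ i, g (f i) else 0 := by
  intro N
  induction N with
  | zero =>
    intro _
    simp [Function.injective_of_subsingleton]
  | succ N ih =>
    intro hN
    push_cast at hN
    have ih' := ih (by nlinarith)
    rw [← (Fin.consEquiv (fun _ : Fin (N+1) => Λ)).sum_comp, Fintype.sum_prod_type,
      Finset.sum_comm, pow_succ]
    refine (mul_le_mul_of_nonneg_right ih' (by linarith)).trans ?_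
    rw [Finset.sum_mul]
    refine Finset.sum_le_sum fun f _ => ?_
    have key : ∀ x, (Function.Injective
        (fun i => var ((Fin.consEquiv (fun _ : Fin (N+1) => Λ)) (x, f) i)) ↔
        (∀ i, var (f i) ≠ var x) ∧ Function.Injective (fun i => var (f i))) := by
      intro x
      have e1 : (fun i => var ((Fin.consEquiv (fun _ : Fin (N+1) => Λ)) (x, f) i)) =
          (Fin.cons (var x) (fun i => var (f i)) : Fin (N+1) → T) := by
        funext i
        refine Fin.cases ?_ (fun i => ?_) i <;> simp [Fin.consEquiv]
      rw [e1, Fin.cons_injective_iff]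
      simp
    by_cases hf : Function.Injective (fun i => var (f i))
    · rw [if_pos hf]
      have hprod : 0 ≤ ∏ i, g (f i) := Finset.prod_nonneg fun i _ => hg _
      have e2 : ∀ x, (if Function.Injective
          (fun i => var ((Fin.consEquiv (fun _ : Fin (N+1) => Λ)) (x, f) i)) then
          ∏ i, g ((Fin.consEquiv (fun _ : Fin (N+1) => Λ)) (x, f) i) else 0) =
          (∏ i, g (f i)) * (if (∀ i, var (f i) ≠ var x) then g x else 0) := by
        intro x
        rw [Fin.prod_univ_succ]
        by_cases hx : ∀ i, var (f i) ≠ var x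
        · rw [if_pos ((key x).mpr ⟨hx, hf⟩), if_pos hx]
          simp [Fin.consEquiv, mul_comm]
        · rw [if_neg (fun h => hx ((key x).mp h).1), if_neg hx, mul_zero]
      simp_rw [e2]
      rw [← Finset.mul_sum]
      refine mul_le_mul_of_nonneg_left ?_ hprod
      have e3 : ∑ x, g x ≤ ∑ x, (if (∀ i, var (f i) ≠ var x) then g x else 0)
          + ∑ i, ∑ x, (if var x = var (f i) then g x else 0) := by
        rw [Finset.sum_comm, ← Finset.sum_add_distrib]
        refine Finset.sum_le_sum fun x _ => ?_
        have hnn : ∀ i, 0 ≤ (if var x = var (f i) then g x else 0) := fun i => by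
          split_ifs
          · exact hg x
          · exact le_rfl
        by_cases hx : ∀ i, var (f i) ≠ var x
        · rw [if_pos hx]
          have := Finset.sum_nonneg (s := Finset.univ) fun i _ => hnn i
          linarith
        · rw [if_neg hx]
          push Not at hx
          obtain ⟨i, hi⟩ := hx
          have := Finset.single_le_sum (s := Finset.univ)
            (f := fun i => if var x = var (f i) then g x else 0) (fun i _ => hnn i)
            (Finset.mem_univ i)
          simp only [hi, if_true] at this
          linarith
      have e4 : ∑ i, ∑ x, (if var x = var (f i) then g x else 0) ≤ N * c0 := by
        have := Finset.sum_le_card_nsmul (Finset.univ : Finset (Fin N))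
          (fun i => ∑ x, (if var x = var (f i) then g x else 0)) c0 (fun i _ => hc _)
        simpa using this
      nlinarith
    · rw [if_neg hf, zero_mul]
      refine Finset.sum_nonneg fun x _ => ?_
      split_ifs
      · exact Finset.prod_nonneg fun i _ => hg _
      · exact le_rfl

/-- literals along the snake -/
def posL {n s : ℕ} (h : Fin n × Bool) (f : Fin (s+s) → Fin n × Bool) :
    Fin (s+s) ⊕ Bool → Fin n × Bool :=
  Sum.elim f (fun b => if b then h else lneg h)

/-- source positions -/
def pa (s : ℕ) : Fin (s+1) ⊕ Fin (s+1) → Fin (s+s) ⊕ Bool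
  | .inl i => (Fin.cons (.inr true) (fun k => .inl (Fin.castAdd s k)) :
      Fin (s+1) → Fin (s+s) ⊕ Bool) i
  | .inr i => (Fin.cons (.inr false) (fun k => .inl (Fin.natAdd s k)) :
      Fin (s+1) → Fin (s+s) ⊕ Bool) i
/-- target positions -/
def pb (s : ℕ) : Fin (s+1) ⊕ Fin (s+1) → Fin (s+s) ⊕ Bool
  | .inl i => (Fin.snoc (fun k => .inl (Fin.castAdd s k)) (.inr false) :
      Fin (s+1) → Fin (s+s) ⊕ Bool) i
  | .inr i => (Fin.snoc (fun k => .inl (Fin.natAdd s k)) (.inr true) :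
      Fin (s+1) → Fin (s+s) ⊕ Bool) i

lemma pa_inj (s : ℕ) : Function.Injective (pa s) := by
  rintro (i | i) (j | j) <;> refine Fin.cases ?_ (fun i => ?_) i <;>
    refine Fin.cases ?_ (fun j => ?_) j <;> simp [pa, Fin.ext_iff] <;> omega

lemma pb_inj (s : ℕ) : Function.Injective (pb s) := by
  rintro (i | i) (j | j) <;> refine Fin.lastCases ?_ (fun i => ?_) i <;>
    refine Fin.lastCases ?_ (fun j => ?_) j <;> simp [pb, Fin.ext_iff] <;> omega

lemma pa_ne_pb (s : ℕ) (i) : pa s i ≠ pb s i := by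
  have key : ∀ (g : Fin s → Fin (s+s)) (hg : Function.Injective g) (b : Bool) (i : Fin (s+1)),
      (Fin.cons (.inr b) (fun k => .inl (g k)) : Fin (s+1) → Fin (s+s) ⊕ Bool) i ≠
      (Fin.snoc (fun k => .inl (g k)) (.inr (!b)) : Fin (s+1) → Fin (s+s) ⊕ Bool) i := by
    intro g hg b i
    refine Fin.lastCases ?_ (fun k => ?_) i
    · rw [Fin.snoc_last]
      cases s with
      | zero => 
        have : Fin.last 0 = 0 := rfl
        rw [this, Fin.cons_zero]; simp
      | succ s => 
        rw [← Fin.succ_last, Fin.cons_succ]; simp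
    · rw [Fin.snoc_castSucc]
      by_cases hk : k.1 = 0
      · have : k.castSucc = 0 := Fin.ext hk
        rw [this, Fin.cons_zero]; simp
      · have : k.castSucc = Fin.succ ⟨k.1 - 1, by omega⟩ := by ext; simp; omega
        rw [this, Fin.cons_succ]
        intro h
        have := hg (Sum.inl_injective h)
        rw [Fin.ext_iff] at this
        simp at this
        omega
  rcases i with i | i
  · exact key _ (Fin.castAdd_injective s s) true i
  · exact key _ (Fin.natAdd_injective s s) false i

lemma pa_or_pb (s : ℕ) (hs : 1 ≤ s) (i) :
    (∃ k, pa s i = .inl k) ∨ (∃ k, pb s i = .inl k) := by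
  obtain ⟨s, rfl⟩ : ∃ k, s = k + 1 := ⟨s - 1, by omega⟩
  rcases i with i | i <;> refine Fin.cases ?_ (fun i => ?_) i
  · right
    have : (0 : Fin (s+1+1)) = Fin.castSucc 0 := rfl
    rw [this]; simp only [pb, Fin.snoc_castSucc]; exact ⟨_, rfl⟩
  · left; simp only [pa, Fin.cons_succ]; exact ⟨_, rfl⟩
  · right
    have : (0 : Fin (s+1+1)) = Fin.castSucc 0 := rfl
    rw [this]; simp only [pb, Fin.snoc_castSucc]; exact ⟨_, rfl⟩
  · left; simp only [pa, Fin.cons_succ]; exact ⟨_, rfl⟩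

/-- valid snake -/
structure SnakeOK {n s : ℕ} (lt : Fin n → Prop) (h : Fin n × Bool) (f : Fin (s+s) → Fin n × Bool) :
    Prop where
  s1 : 1 ≤ s
  hub : ¬ lt h.1
  light : ∀ k, lt (f k).1
  inj : Function.Injective (fun k => (f k).1)

/-- edge sources -/
def ssrc {n s : ℕ} (h : Fin n × Bool) (f : Fin (s+s) → Fin n × Bool) (i : Fin (s+1) ⊕ Fin (s+1)) :
    Fin n × Bool := posL h f (pa s i)
/-- edge targets -/
def stgt {n s : ℕ} (h : Fin n × Bool) (f : Fin (s+s) → Fin n × Bool) (i : Fin (s+1) ⊕ Fin (s+1)) :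
    Fin n × Bool := posL h f (pb s i)

namespace SnakeOK
variable {n s : ℕ} {lt : Fin n → Prop} {h : Fin n × Bool} {f : Fin (s+s) → Fin n × Bool}

lemma posL_hub (b : Bool) : (posL h f (.inr b)).1 = h.1 := by
  cases b <;> simp [posL]

lemma posP (H : SnakeOK lt h f) {x y} (h1 : lt (posL h f x).1)
    (h2 : (posL h f x).1 = (posL h f y).1) : x = y := by
  rcases x with x | x
  · rcases y with y | y
    · exact congrArg _ (H.inj h2)
    · rw [posL_hub] at h2
      rw [h2] at h1
      exact absurd h1 H.hub
  · rw [posL_hub] at h1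
    exact absurd h1 H.hub

lemma posI (H : SnakeOK lt h f) : Function.Injective (posL h f) := by
  intro x y hxy
  by_cases h1 : lt (posL h f x).1
  · exact H.posP h1 (congrArg Prod.fst hxy)
  · rcases x with x | x
    · exact absurd (H.light x) h1
    · rcases y with y | y
      · rw [hxy] at h1; exact absurd (H.light y) h1
      · have := lneg_ne h
        cases x <;> cases y <;> simp [posL, this, this.symm] at hxy ⊢

lemma srcI (H : SnakeOK lt h f) : Function.Injective (ssrc h f) := H.posI.comp (pa_inj s)
lemma tgtI (H : SnakeOK lt h f) : Function.Injective (stgt h f) := H.posI.comp (pb_inj s)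

lemma P (H : SnakeOK lt h f) {i j} (h1 : lt (ssrc h f i).1)
    (h2 : (ssrc h f i).1 = (stgt h f j).1) : ssrc h f i = stgt h f j :=
  congrArg (posL h f) (H.posP h1 h2)

lemma N (H : SnakeOK lt h f) (i) : ssrc h f i ≠ stgt h f i := fun e => pa_ne_pb s i (H.posI e)

lemma Q (H : SnakeOK lt h f) (i) : lt (ssrc h f i).1 ∨ lt (stgt h f i).1 := by
  rcases pa_or_pb s H.s1 i with ⟨k, hk⟩ | ⟨k, hk⟩
  · left; rw [ssrc, hk]; exact H.light k
  · right; rw [stgt, hk]; exact H.light k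

lemma pos_cases (x) : (∃ k, (posL h f x).1 = (f k).1) ∨ (posL h f x).1 = h.1 := by
  rcases x with x | x
  · left; exact ⟨x, rfl⟩
  · right; exact posL_hub x

lemma pos_hub (H : SnakeOK lt h f) {x} (h1 : ¬ lt (posL h f x).1) : (posL h f x).1 = h.1 := by
  rcases pos_cases (h := h) (f := f) x with ⟨k, hk⟩ | hk
  · rw [hk] at h1; exact absurd (H.light k) h1
  · exact hk

lemma pos_light (H : SnakeOK lt h f) {x} (h1 : lt (posL h f x).1) :
    ∃ k, (posL h f x).1 = (f k).1 := by
  rcases pos_cases (h := h) (f := f) x with hk | hk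
  · exact hk
  · rw [hk] at h1; exact absurd h1 H.hub

lemma noLoop (H : SnakeOK lt h f) (i) : (ssrc h f i).1 ≠ (stgt h f i).1 := by
  intro e
  rcases H.Q i with h1 | h1
  · exact H.N i (H.P h1 e)
  · exact H.N i (H.P (e ▸ h1) e)

lemma mixed (H : SnakeOK lt h f) {i j} {y : Fin n × Bool} (hy : lt y.1) (h1 : ssrc h f i = y)
    (h2 : stgt h f j = lneg y) : False := by
  have := H.P (i := i) (j := j) (h1 ▸ hy) (by rw [h1, h2, lneg_fst])
  rw [h1, h2] at this
  exact lneg_ne y this.symm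

lemma mixed' (H : SnakeOK lt h f) {i j} {y : Fin n × Bool} (hy : lt y.1)
    (h1 : ssrc h f i = lneg y) (h2 : stgt h f j = y) : False :=
  H.mixed (y := lneg y) (by simpa using hy) h1 (by simpa using h2)

lemma Ev_ne (H : SnakeOK lt h f) {i j} (hij : i ≠ j) :
    Ev (ssrc h f i) (stgt h f i) ≠ Ev (ssrc h f j) (stgt h f j) := by
  intro e
  rcases Ev_eq_iff.mp e with ⟨h1, -⟩ | ⟨h1, h2⟩
  · exact hij (H.srcI h1)
  · rcases H.Q i with h3 | h3
    · exact H.mixed h3 rfl (by rw [h1, lneg_lneg] : stgt h f j = lneg (ssrc h f i))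
    · exact H.mixed' h3 (by rw [h2, lneg_lneg] : ssrc h f j = lneg (stgt h f i)) rfl

lemma Ev_disjoint (H : SnakeOK lt h f) (i j) (hij : i ≠ j) :
    Disjoint (Ev (ssrc h f i) (stgt h f i)) (Ev (ssrc h f j) (stgt h f j)) :=
  (Ev_eq_or_disj _ _ _ _).resolve_left (H.Ev_ne hij)

lemma Ev_inj (H : SnakeOK lt h f) :
    Function.Injective (fun i => Ev (ssrc h f i) (stgt h f i)) := by
  intro i j hij
  by_contra hne
  exact H.Ev_ne hne hij

end SnakeOK

/-- overlap indicator -/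
noncomputable def BB {n s : ℕ} (h : Fin n × Bool) (f : Fin (s+s) → Fin n × Bool)
    (y z : Fin n × Bool) : ℝ :=
  if ∃ i, Ev (ssrc h f i) (stgt h f i) = Ev y z then 1 else 0

lemma BB_nonneg {n s : ℕ} (h : Fin n × Bool) (f : Fin (s+s) → Fin n × Bool)
    (y z : Fin n × Bool) : 0 ≤ BB h f y z := by
  unfold BB; split_ifs <;> norm_num

lemma sum_ite_le_one' {Λ : Type*} [Fintype Λ] (P : Λ → Prop) [DecidablePred P] (h : ∀ z z', P z → P z' → z = z') :
    ∑ z, (if P z then (1:ℝ) else 0) ≤ 1 := by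
  rw [Finset.sum_boole]
  have : (Finset.univ.filter P).card ≤ 1 := Finset.card_le_one.mpr fun a ha b hb =>
    h a b (Finset.mem_filter.mp ha).2 (Finset.mem_filter.mp hb).2
  exact_mod_cast this

lemma sum_ite_zero' {Λ : Type*} [Fintype Λ] (P : Λ → Prop) [DecidablePred P] (h : ∀ z, ¬ P z) :
    ∑ z, (if P z then (1:ℝ) else 0) = 0 :=
  Finset.sum_eq_zero fun z _ => if_neg (h z)

section rows
variable {n s : ℕ} {lt : Fin n → Prop} {h : Fin n × Bool} {f : Fin (s+s) → Fin n × Bool}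
  {Λ : Type*} [Fintype Λ] {e : Λ → Fin n × Bool}

lemma BB_row (H : SnakeOK lt h f) (he : Function.Injective e) (hl : ∀ x, lt (e x).1) (x : Λ) :
    ∑ z, BB h f (e x) (e z) ≤
      if x ∈ Finset.univ.filter (fun x => ∃ k, (e x).1 = (f k).1) then 1 else 0 := by
  unfold BB
  split_ifs with hx
  · refine sum_ite_le_one' (Λ := Λ) _ ?_
    rintro z z' ⟨i, hi⟩ ⟨j, hj⟩
    rcases Ev_eq_iff.mp hi with ⟨i1, i2⟩ | ⟨i1, i2⟩ <;>
      rcases Ev_eq_iff.mp hj with ⟨j1, j2⟩ | ⟨j1, j2⟩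
    · have := H.srcI (i1.trans j1.symm); subst this
      exact he (i2.symm.trans j2)
    · exact (H.mixed (hl x) i1 j2).elim
    · exact (H.mixed (hl x) j1 i2).elim
    · have := H.tgtI (i2.trans j2.symm); subst this
      exact he (lneg_inj (i1.symm.trans j1))
  · refine (sum_ite_zero' (Λ := Λ) _ ?_).le
    rintro z ⟨i, hi⟩
    apply hx
    rw [Finset.mem_filter]
    refine ⟨Finset.mem_univ _, ?_⟩
    rcases Ev_eq_iff.mp hi with ⟨i1, i2⟩ | ⟨i1, i2⟩
    · have := H.pos_light (x := pa s i) (by change lt (ssrc h f i).1; rw [i1]; exact hl x)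
      change ∃ k, (ssrc h f i).1 = _ at this
      rwa [i1] at this
    · have := H.pos_light (x := pb s i) (by change lt (stgt h f i).1; rw [i2]; exact hl x)
      change ∃ k, (stgt h f i).1 = _ at this
      rwa [i2] at this

lemma BB_col (H : SnakeOK lt h f) (he : Function.Injective e) (hl : ∀ x, lt (e x).1) (z : Λ) :
    ∑ x, BB h f (e x) (e z) ≤ 1 := by
  unfold BB
  refine sum_ite_le_one' (Λ := Λ) _ ?_
  rintro x x' ⟨i, hi⟩ ⟨j, hj⟩
  rcases Ev_eq_iff.mp hi with ⟨i1, i2⟩ | ⟨i1, i2⟩ <;>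
    rcases Ev_eq_iff.mp hj with ⟨j1, j2⟩ | ⟨j1, j2⟩
  · have := H.tgtI (i2.trans j2.symm); subst this
    exact he (i1.symm.trans j1)
  · exact (H.mixed' (hl z) j1 i2).elim
  · exact (H.mixed' (hl z) i1 j2).elim
  · have := H.srcI (i1.trans j1.symm); subst this
    exact he (lneg_inj (i2.symm.trans j2))

lemma BB_col2 (H : SnakeOK lt h f) (he : Function.Injective e) (t : Fin n × Bool) :
    ∑ x, BB h f (e x) t ≤ 2 := by
  have h1 : ∑ x : Λ, (if ∃ i, ssrc h f i = e x ∧ stgt h f i = t then (1:ℝ) else 0) ≤ 1 := by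
    refine sum_ite_le_one' (Λ := Λ) _ ?_
    rintro x x' ⟨i, i1, i2⟩ ⟨j, j1, j2⟩
    have := H.tgtI (i2.trans j2.symm); subst this
    exact he (i1.symm.trans j1)
  have h2 : ∑ x : Λ, (if ∃ i, ssrc h f i = lneg t ∧ stgt h f i = lneg (e x) then (1:ℝ) else 0)
      ≤ 1 := by
    refine sum_ite_le_one' (Λ := Λ) _ ?_
    rintro x x' ⟨i, i1, i2⟩ ⟨j, j1, j2⟩
    have := H.srcI (i1.trans j1.symm); subst this
    exact he (lneg_inj (i2.symm.trans j2))
  calc ∑ x, BB h f (e x) t ≤ ∑ x : Λ, ((if ∃ i, ssrc h f i = e x ∧ stgt h f i = t then (1:ℝ) else 0)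
        + (if ∃ i, ssrc h f i = lneg t ∧ stgt h f i = lneg (e x) then (1:ℝ) else 0)) := by
        refine Finset.sum_le_sum fun x _ => ?_
        unfold BB
        split_ifs with g1 g2 g3 g3 g2 g3 g3 <;> try norm_num
        obtain ⟨i, hi⟩ := g1
        rcases Ev_eq_iff.mp hi with h | h
        · exact g2 ⟨i, h⟩
        · exact g3 ⟨i, h⟩
    _ ≤ 2 := by rw [Finset.sum_add_distrib]; linarith

lemma BB_contra (y z : Fin n × Bool) : BB h f y z = BB h f (lneg z) (lneg y) := by
  unfold BB; rw [Ev_contra]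

lemma BB_row2 (H : SnakeOK lt h f) (he : Function.Injective e) (t : Fin n × Bool) :
    ∑ x, BB h f t (e x) ≤ 2 := by
  have := BB_col2 H (e := fun x => lneg (e x)) (lneg_injective.comp he) (lneg t)
  simp_rw [← BB_contra] at this
  exact this

lemma BB_col0 (H : SnakeOK lt h f) {t : Fin n × Bool} (ht : ¬ lt t.1) (hne : t.1 ≠ h.1) :
    ∑ x : Λ, BB h f (e x) t ≤ 0 := by
  unfold BB
  refine (sum_ite_zero' (Λ := Λ) _ ?_).le
  rintro x ⟨i, hi⟩
  apply hne
  rcases Ev_eq_iff.mp hi with ⟨i1, i2⟩ | ⟨i1, i2⟩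
  · have := H.pos_hub (x := pb s i) (by change ¬ lt (stgt h f i).1; rw [i2]; exact ht)
    change (stgt h f i).1 = _ at this
    rwa [i2] at this
  · have := H.pos_hub (x := pa s i) (by change ¬ lt (ssrc h f i).1; rw [i1]; exact ht)
    change (ssrc h f i).1 = _ at this
    rwa [i1] at this

lemma BB_row0 (H : SnakeOK lt h f) {t : Fin n × Bool} (ht : ¬ lt t.1) (hne : t.1 ≠ h.1) :
    ∑ x : Λ, BB h f t (e x) ≤ 0 := by
  have := BB_col0 H (e := fun x => lneg (e x)) (t := lneg t) ht hne
  simp_rw [← BB_contra] at this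
  exact this

lemma V_card (he : Function.Injective e) :
    ((Finset.univ.filter (fun x : Λ => ∃ k, (e x).1 = (f k).1)).card : ℝ) ≤ 4 * s := by
  have h1 : (Finset.univ.filter (fun x : Λ => ∃ k, (e x).1 = (f k).1)).image e ⊆
      (Finset.univ : Finset (Fin (s+s) × Bool)).image (fun q => ((f q.1).1, q.2)) := by
    intro y hy
    obtain ⟨x, hx, rfl⟩ := Finset.mem_image.mp hy
    obtain ⟨k, hk⟩ := (Finset.mem_filter.mp hx).2
    exact Finset.mem_image.mpr ⟨(k, (e x).2), Finset.mem_univ _, by rw [← hk]⟩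
  have h2 := Finset.card_le_card h1
  rw [Finset.card_image_of_injective _ he] at h2
  have h3 := h2.trans Finset.card_image_le
  simp at h3
  have h4 : (Finset.univ.filter (fun x : Λ => ∃ k, (e x).1 = (f k).1)).card ≤ 4 * s := by
    omega
  exact_mod_cast h4

end rows

end Snake

section SnakeSum

variable {n s : ℕ}

lemma ssrc_inl (h : Fin n × Bool) (f : Fin (s+s) → Fin n × Bool) (i : Fin (s+1)) :
    ssrc h f (.inl i) = srcE (fun k => f (Fin.castAdd s k)) h i := by
  refine Fin.cases ?_ (fun i => ?_) i <;> simp [ssrc, pa, posL, srcE]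
lemma ssrc_inr (h : Fin n × Bool) (f : Fin (s+s) → Fin n × Bool) (i : Fin (s+1)) :
    ssrc h f (.inr i) = srcE (fun k => f (Fin.natAdd s k)) (lneg h) i := by
  refine Fin.cases ?_ (fun i => ?_) i <;> simp [ssrc, pa, posL, srcE]
lemma stgt_inl (h : Fin n × Bool) (f : Fin (s+s) → Fin n × Bool) (i : Fin (s+1)) :
    stgt h f (.inl i) = tgtE (fun k => f (Fin.castAdd s k)) (lneg h) i := by
  refine Fin.lastCases ?_ (fun i => ?_) i <;> simp [stgt, pb, posL, tgtE]
lemma stgt_inr (h : Fin n × Bool) (f : Fin (s+s) → Fin n × Bool) (i : Fin (s+1)) :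
    stgt h f (.inr i) = tgtE (fun k => f (Fin.natAdd s k)) h i := by
  refine Fin.lastCases ?_ (fun i => ?_) i <;> simp [stgt, pb, posL, tgtE]

lemma prod_snake (ξ : Fin n × Bool → ℝ) (μ : ℝ) (h : Fin n × Bool)
    (f : Fin (s+s) → Fin n × Bool) :
    ∏ i, (μ * ξ (ssrc h f i) * ξ (stgt h f i)) =
      μ ^ (2*s+2) * (ξ h * ξ (lneg h)) ^ 2 * ∏ k, ξ (f k) ^ 2 := by
  have key : ∀ (Y : Fin s → Fin n × Bool) (a b : Fin n × Bool),
      ∏ i, (μ * ξ (srcE Y a i) * ξ (tgtE Y b i)) = μ ^ (s+1) * (ξ a * ξ b) * ∏ k, ξ (Y k) ^ 2 := by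
    intro Y a b
    simp_rw [mul_assoc]
    rw [Finset.prod_mul_distrib, Finset.prod_const,
      Finset.prod_mul_distrib (f := fun i => ξ (srcE Y a i)), Fin.prod_univ_succ,
      Fin.prod_univ_castSucc (fun i => ξ (tgtE Y b i))]
    simp only [srcE, tgtE, Fin.cons_zero, Fin.cons_succ, Fin.snoc_castSucc,
      Fin.snoc_last, Finset.card_univ, Fintype.card_fin, Finset.prod_pow]
    ring
  rw [Fintype.prod_sum_type]
  simp_rw [ssrc_inl, ssrc_inr, stgt_inl, stgt_inr]
  rw [key, key, Fin.prod_univ_add]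
  have : μ ^ (2*s+2) = μ ^ (s+1) * μ ^ (s+1) := by rw [← pow_add]; congr 1; ring
  rw [this]
  ring

lemma sum_snake {Λ : Type*} [Fintype Λ] (e : Λ → Fin n × Bool)
    (M : Fin n × Bool → Fin n × Bool → ℝ) (h : Fin n × Bool) :
    ∑ f : Fin (s+s) → Λ, ∏ i, M (ssrc h (fun k => e (f k)) i) (stgt h (fun k => e (f k)) i)
      = wk e M s h (lneg h) * wk e M s (lneg h) h := by
  rw [← (Fin.appendEquiv s s).sum_comp, Fintype.sum_prod_type, ← wk_eq, ← wk_eq,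
    Finset.sum_mul_sum]
  refine Finset.sum_congr rfl fun a _ => Finset.sum_congr rfl fun b _ => ?_
  rw [Fintype.prod_sum_type]
  simp_rw [ssrc_inl, ssrc_inr, stgt_inl, stgt_inr]
  simp only [Fin.appendEquiv, Equiv.coe_fn_mk, Fin.append_left, Fin.append_right]

lemma chain_sat {m k : ℕ} {Φ : Fin m → (Fin n × Bool) × (Fin n × Bool)} {A : Fin n → Bool}
    (hA : ∀ j, A (Φ j).1.1 = (Φ j).1.2 ∨ A (Φ j).2.1 = (Φ j).2.2)
    (Y : Fin k → Fin n × Bool) (a b : Fin n × Bool)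
    (hc : ∀ i, 0 < cnt (Ev (srcE Y a i) (tgtE Y b i)) Φ) (ha : A a.1 = a.2) : A b.1 = b.2 := by
  have key : ∀ i : Fin (k+1), A (srcE Y a i).1 = (srcE Y a i).2 := by
    intro i
    induction i using Fin.induction with
    | zero => exact ha
    | succ i ih =>
      have := sat_step hA (hc i.castSucc) ih
      simpa [tgtE, srcE] using this
  have := sat_step hA (hc (Fin.last k)) (key _)
  simpa [tgtE] using this

lemma snake_unsat {m : ℕ} {Φ : Fin m → (Fin n × Bool) × (Fin n × Bool)} (h : Fin n × Bool)
    (f : Fin (s+s) → Fin n × Bool) (hc : ∀ i, 0 < cnt (Ev (ssrc h f i) (stgt h f i)) Φ) :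
    ¬ Sat2 Φ := by
  rintro ⟨A, hA⟩
  have c1 := chain_sat hA (fun k => f (Fin.castAdd s k)) h (lneg h) (fun i => by
    have := hc (.inl i); rwa [ssrc_inl, stgt_inl] at this)
  have c2 := chain_sat hA (fun k => f (Fin.natAdd s k)) (lneg h) h (fun i => by
    have := hc (.inr i); rwa [ssrc_inr, stgt_inr] at this)
  by_cases h1 : A h.1 = h.2
  · have := c1 h1
    simp [lneg, h1] at this
  · refine h1 (c2 ?_)
    simp [lneg]
    revert h1
    cases A h.1 <;> cases h.2 <;> simp

end SnakeSum

section Core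

/-- normalised weight -/
noncomputable def xiL (n : ℕ) (p : ℕ → ℝ) (x : Fin n × Bool) : ℝ :=
  p x.1 / √(2 * ∑ i ∈ Finset.range n, p i ^ 2)

lemma GoodP.Spos {n : ℕ} {p : ℕ → ℝ} (hg : GoodP n p) : 0 < ∑ i ∈ Finset.range n, p i ^ 2 := by
  have hn : 0 < n := by
    rcases Nat.eq_zero_or_pos n with rfl | h
    · have := hg.sum1; simp at this
    · exact h
  rw [Finset.sum_range]
  exact Finset.sum_pos (fun i _ => pow_pos (hg.pos i) 2) ⟨⟨0, hn⟩, Finset.mem_univ _⟩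

lemma xiL_pos {n : ℕ} {p : ℕ → ℝ} (hg : GoodP n p) (x : Fin n × Bool) : 0 < xiL n p x := by
  have := hg.Spos
  have := hg.pos x.1
  unfold xiL
  positivity

lemma xiL_mul {n : ℕ} {p : ℕ → ℝ} (hg : GoodP n p) (m : ℝ) (x y : Fin n × Bool) :
    m * ((1 - ∑ i ∈ Finset.range n, p i ^ 2)⁻¹ / 2 * p x.1 * p y.1) =
    (m * (1 - ∑ i ∈ Finset.range n, p i ^ 2)⁻¹ * ∑ i ∈ Finset.range n, p i ^ 2)
      * xiL n p x * xiL n p y := by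
  have hS := hg.Spos
  unfold xiL
  set S := ∑ i ∈ Finset.range n, p i ^ 2
  have h1 : √(2 * S) * √(2 * S) = 2 * S := Real.mul_self_sqrt (by positivity)
  have h2 : √(2 * S) ≠ 0 := by positivity
  have : p x.1 / √(2 * S) * (p y.1 / √(2 * S)) = p x.1 * p y.1 / (2 * S) := by
    rw [div_mul_div_comm, h1]
  rw [mul_assoc _ (p x.1 / √(2 * S)), this]
  field_simp

set_option maxHeartbeats 1000000 in
/-- the snake walk bound, squared form -/
lemma Z_bound {n s : ℕ} {lt : Fin n → Prop} (ξ : Fin n × Bool → ℝ) {μ κ θ Kc H2 ℓ : ℝ}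
    (hξ : ∀ x, 0 < ξ x) (hneg : ∀ x, ξ (lneg x) = ξ x) (hμ : 0 ≤ μ) (hκ0 : 0 < κ) (hKc : 0 ≤ Kc)
    (hκl : ∀ x : Fin n × Bool, lt x.1 → ξ x ≤ κ) (hκh : ∀ x : Fin n × Bool, ¬ lt x.1 → κ ≤ ξ x)
    (hℓ : ∀ x, ξ x ^ 2 ≤ ℓ)
    (hθ : θ = ∑ x : {x : Fin n × Bool // lt x.1}, ξ x ^ 2)
    (hH : H2 = ∑ x : {x : Fin n × Bool // ¬ lt x.1}, ξ x ^ 2)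
    (hK : μ * θ * Kc = 1 + Kc) (hbig : 1 ≤ (μ * θ) ^ s * κ ^ 2)
    {h : Fin n × Bool} {f : Fin (s+s) → Fin n × Bool} (H : SnakeOK lt h f) :
    ∑ h' : {x : Fin n × Bool // ¬ lt x.1}, κ ^ 2 / ξ h' ^ 2 *
      (wk (fun x : {x : Fin n × Bool // lt x.1} => x.1) (fun y z => μ * ξ y * ξ z + BB h f y z) s h'
        (lneg h') *
       wk (fun x : {x : Fin n × Bool // lt x.1} => x.1) (fun y z => μ * ξ y * ξ z + BB h f y z) s
        (lneg h') h')
      ≤ κ ^ 2 * (((μ * (θ + 4 * s * Kc * κ ^ 2)) ^ s) ^ 2 *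
        (μ ^ 2 * H2 + 2 * (μ * (1 + 2 * Kc) ^ 2 + 2 * μ + 4) ^ 2 * ℓ)) := by
  set e : {x : Fin n × Bool // lt x.1} → Fin n × Bool := fun x => x.1 with he
  set M : Fin n × Bool → Fin n × Bool → ℝ := fun y z => μ * ξ y * ξ z + BB h f y z with hM
  have heI : Function.Injective e := Subtype.val_injective
  have hl : ∀ x, lt (e x).1 := fun x => x.2
  set νs := (μ * (θ + 4 * s * Kc * κ ^ 2)) ^ s with hνs
  set C2 := μ * (1 + 2 * Kc) ^ 2 + 2 * μ + 4 with hC2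
  have hM0 : ∀ y z, 0 ≤ M y z := fun y z => by
    have := hξ y; have := hξ z; have := BB_nonneg h f y z
    simp only [hM]; positivity
  have hθ0 : 0 ≤ θ := by rw [hθ]; exact Finset.sum_nonneg fun x _ => sq_nonneg _
  have hνbig : 1 ≤ νs * κ ^ 2 := by
    refine hbig.trans (mul_le_mul_of_nonneg_right ?_ (by positivity))
    refine pow_le_pow_left₀ (by positivity) (mul_le_mul_of_nonneg_left ?_ hμ) _
    have : 0 ≤ 4 * s * Kc * κ ^ 2 := by positivity
    linarith
  have hνs0 : 0 ≤ νs := by positivity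
  have gen : ∀ (a b : Fin n × Bool) (J0 r0 : ℝ), ∑ x, BB h f (e x) b ≤ J0 →
      ∑ x, BB h f a (e x) ≤ r0 → wk e M s a b ≤
      νs * μ * (ξ b + J0 * Kc * κ) * (ξ a + r0 * Kc * κ) + μ * ξ a * κ * J0 + r0 * J0 := by
    intro a b J0 r0 hJ hr
    exact wk_bound e (BB h f) ξ (cV := 4 * s) _ (BB_nonneg h f) (fun y => (hξ y).le)
      (fun x => hκl _ x.2) hκ0.le hμ hKc hθ (V_card (f := f) heI) (BB_row H heI hl)
      (BB_col H heI hl) hK hJ hr s H.s1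
  have non : ∀ a : Fin n × Bool, ¬ lt a.1 → a.1 ≠ h.1 → wk e M s a (lneg a) ≤ νs * μ * ξ a ^ 2 := by
    intro a ha hne
    refine (gen a (lneg a) 0 0 (BB_col0 H ha hne) (BB_row0 H ha hne)).trans (le_of_eq ?_)
    rw [hneg]; ring
  have mat : ∀ a : Fin n × Bool, ¬ lt a.1 → wk e M s a (lneg a) ≤ νs * C2 * ξ a ^ 2 := by
    intro a ha
    refine (gen a (lneg a) 2 2 (BB_col2 H heI _) (BB_row2 H heI _)).trans ?_
    rw [hneg]
    have h1 := hκh a ha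
    have h2 := hξ a
    have h3 : κ ^ 2 ≤ ξ a ^ 2 := pow_le_pow_left₀ hκ0.le h1 2
    have h4 : 1 ≤ νs * ξ a ^ 2 := hνbig.trans (mul_le_mul_of_nonneg_left h3 hνs0)
    have h5 : ξ a + 2 * Kc * κ ≤ (1 + 2 * Kc) * ξ a := by nlinarith
    have h6 : (ξ a + 2 * Kc * κ) * (ξ a + 2 * Kc * κ) ≤ ((1 + 2 * Kc) * ξ a) * ((1 + 2 * Kc) * ξ a) :=
      mul_le_mul h5 h5 (by positivity) (by positivity)
    have h7 := mul_le_mul_of_nonneg_left h6 (mul_nonneg hνs0 hμ)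
    have h8 : μ * ξ a * κ * 2 ≤ 2 * μ * (νs * ξ a ^ 2) := by
      have hx1 : ξ a * κ ≤ 1 * ξ a ^ 2 := by nlinarith
      have hℓ1 : ξ a ^ 2 ≤ νs * ξ a ^ 2 := by
        have hνs1 : 1 ≤ νs := by
          by_contra hcon
          push Not at hcon
          have hθμ : (μ * θ) ^ s ≤ νs := by
            refine pow_le_pow_left₀ (by positivity) (mul_le_mul_of_nonneg_left ?_ hμ) _
            have : 0 ≤ 4 * s * Kc * κ ^ 2 := by positivity
            linarith
          have : 1 ≤ μ * θ := by
            by_contra hc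
            push Not at hc
            nlinarith
          have := one_le_pow₀ this (n := s)
          linarith
        nlinarith [sq_nonneg (ξ a)]
      have := mul_le_mul_of_nonneg_left (show ξ a * κ ≤ νs * ξ a ^ 2 by linarith) hμ
      linarith
    rw [hC2]
    linarith
  have wnn : ∀ a b, 0 ≤ wk e M s a b := fun a b => wk_nonneg e M hM0 s a b
  have term : ∀ h' : {x : Fin n × Bool // ¬ lt x.1}, κ ^ 2 / ξ h' ^ 2 *
      (wk e M s h' (lneg h') * wk e M s (lneg h') h') ≤
      κ ^ 2 * νs ^ 2 * (μ ^ 2 * ξ h' ^ 2) +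
        (if h'.1.1 = h.1 then κ ^ 2 * νs ^ 2 * (C2 ^ 2 * ℓ) else 0) := by
    intro h'
    have h0 := hξ h'
    have hC20 : 0 ≤ C2 := by positivity
    by_cases hv : h'.1.1 = h.1
    · rw [if_pos hv]
      have a1 := mat h' h'.2
      have a2 := mat (lneg h') h'.2
      rw [lneg_lneg, hneg] at a2
      have a3 := mul_le_mul a1 a2 (wnn _ _) (by positivity)
      have a4 := mul_le_mul_of_nonneg_left a3 (by positivity : 0 ≤ κ ^ 2 / ξ h' ^ 2)
      have a5 : κ ^ 2 / ξ h' ^ 2 * (νs * C2 * ξ h' ^ 2 * (νs * C2 * ξ h' ^ 2)) =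
          κ ^ 2 * νs ^ 2 * (C2 ^ 2 * ξ h' ^ 2) := by field_simp
      have a6 : κ ^ 2 * νs ^ 2 * (C2 ^ 2 * ξ h' ^ 2) ≤ κ ^ 2 * νs ^ 2 * (C2 ^ 2 * ℓ) := by
        have := hℓ h'
        gcongr
      have a7 : 0 ≤ κ ^ 2 * νs ^ 2 * (μ ^ 2 * ξ h' ^ 2) := by positivity
      linarith
    · rw [if_neg hv, add_zero]
      have a1 := non h' h'.2 hv
      have a2 := non (lneg h') h'.2 hv
      rw [lneg_lneg, hneg] at a2
      have a3 := mul_le_mul a1 a2 (wnn _ _) (by positivity)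
      have a4 := mul_le_mul_of_nonneg_left a3 (by positivity : 0 ≤ κ ^ 2 / ξ h' ^ 2)
      have a5 : κ ^ 2 / ξ h' ^ 2 * (νs * μ * ξ h' ^ 2 * (νs * μ * ξ h' ^ 2)) =
          κ ^ 2 * νs ^ 2 * (μ ^ 2 * ξ h' ^ 2) := by field_simp
      linarith
  refine (Finset.sum_le_sum fun h' _ => term h').trans ?_
  rw [Finset.sum_add_distrib, ← Finset.mul_sum, ← Finset.mul_sum, ← hH]
  have hℓ0 : 0 ≤ ℓ := le_trans (sq_nonneg _) (hℓ h)
  have cnt2 : ∑ h' : {x : Fin n × Bool // ¬ lt x.1}, (if h'.1.1 = h.1 then κ ^ 2 * νs ^ 2 * (C2 ^ 2 * ℓ) else 0)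
      ≤ 2 * (κ ^ 2 * νs ^ 2 * (C2 ^ 2 * ℓ)) := by
    rw [← Finset.sum_filter, Finset.sum_const, nsmul_eq_mul]
    refine mul_le_mul_of_nonneg_right ?_ (by positivity)
    have : ((Finset.univ.filter fun h' : {x : Fin n × Bool // ¬ lt x.1} => h'.1.1 = h.1).image
        (fun x => x.1)) ⊆ ({h, lneg h} : Finset (Fin n × Bool)) := by
      intro y hy
      obtain ⟨x, hx, rfl⟩ := Finset.mem_image.mp hy
      have := eq_or_lneg (Finset.mem_filter.mp hx).2
      simpa using this
    have h2 := (Finset.card_le_card this).trans Finset.card_le_two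
    rw [Finset.card_image_of_injective _ Subtype.val_injective] at h2
    exact_mod_cast h2
  linarith

end Core

section Core2

lemma m_wt {n m : ℕ} {p : ℕ → ℝ} (hg : GoodP n p) {a b : Fin n × Bool} (hab : a.1 ≠ b.1) :
    (m:ℝ) * wt (clauseProb2 n p) (Ev a b) =
      ((m:ℝ) * (1 - ∑ i ∈ Finset.range n, p i ^ 2)⁻¹ * ∑ i ∈ Finset.range n, p i ^ 2)
        * xiL n p a * xiL n p b := by
  rw [wt_Ev hab, xiL_mul hg]

lemma m_wt_le {n m : ℕ} {p : ℕ → ℝ} (hg : GoodP n p) (a b : Fin n × Bool) :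
    (m:ℝ) * wt (clauseProb2 n p) (Ev a b) ≤
      ((m:ℝ) * (1 - ∑ i ∈ Finset.range n, p i ^ 2)⁻¹ * ∑ i ∈ Finset.range n, p i ^ 2)
        * xiL n p a * xiL n p b := by
  rw [← xiL_mul hg]
  exact mul_le_mul_of_nonneg_left (wt_Ev_le hg a b) (Nat.cast_nonneg _)

lemma xiL_lneg {n : ℕ} {p : ℕ → ℝ} (x : Fin n × Bool) : xiL n p (lneg x) = xiL n p x := rfl

set_option maxHeartbeats 1000000 in
/-- core second moment bound -/
lemma core {n m s : ℕ} {p : ℕ → ℝ} (hg : GoodP n p) (hs1 : 1 ≤ s) (hm : 1 ≤ m) (lt : Fin n → Prop)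
    {μ κ θ Kc H2 ℓ : ℝ}
    (hμ : μ = (m:ℝ) * (1 - ∑ i ∈ Finset.range n, p i ^ 2)⁻¹ * ∑ i ∈ Finset.range n, p i ^ 2)
    (hκ0 : 0 < κ) (hKc : 0 ≤ Kc)
    (hκl : ∀ x : Fin n × Bool, lt x.1 → xiL n p x ≤ κ)
    (hκh : ∀ x : Fin n × Bool, ¬ lt x.1 → κ ≤ xiL n p x)
    (hℓ : ∀ x, xiL n p x ^ 2 ≤ ℓ)
    (hθ : θ = ∑ x : {x : Fin n × Bool // lt x.1}, xiL n p x ^ 2)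
    (hH : H2 = ∑ x : {x : Fin n × Bool // ¬ lt x.1}, xiL n p x ^ 2)
    (hK : μ * θ * Kc = 1 + Kc) (hbig : 1 ≤ (μ * θ) ^ s * κ ^ 2) (hb : 4 * s * κ ^ 2 ≤ θ) :
    ((m.descFactorial (2*s+2) : ℝ) / (m:ℝ) ^ (2*s+2)) ^ 2 *
      (μ ^ 2 * H2 * ((μ * (θ - 4 * s * κ ^ 2)) ^ s) ^ 2)
      ≤ (1 - probSat2 n m p) * (((μ * (θ + 4 * s * Kc * κ ^ 2)) ^ s) ^ 2 *
        (μ ^ 2 * H2 + 2 * (μ * (1 + 2 * Kc) ^ 2 + 2 * μ + 4) ^ 2 * ℓ)) := by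
  set ξ := xiL n p with hξd
  set w := clauseProb2 n p with hw
  have hξ : ∀ x, 0 < ξ x := xiL_pos hg
  have hw0 : ∀ c, 0 ≤ w c := clauseProb_nonneg hg
  have hw1 : ∑ c, w c = 1 := clauseProb_sum hg
  have hS := hg.Spos
  have hμ0 : 0 ≤ μ := by
    have : 0 ≤ (1 - ∑ i ∈ Finset.range n, p i ^ 2)⁻¹ := inv_nonneg.mpr (by linarith [hg.lt1])
    rw [hμ]; positivity
  have hm0 : (m:ℝ) ≠ 0 := by positivity
  have hZb := @Z_bound n s lt ξ μ κ θ Kc H2 ℓ hξ (fun x => rfl) hμ0 hκ0 hKc hκl hκh hℓ hθ hH hK hbig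
  set Z := ((μ * (θ + 4 * s * Kc * κ ^ 2)) ^ s) ^ 2 *
        (μ ^ 2 * H2 + 2 * (μ * (1 + 2 * Kc) ^ 2 + 2 * μ + 4) ^ 2 * ℓ) with hZ
  set Λ := {x : Fin n × Bool // lt x.1} with hΛ
  set Hb := {x : Fin n × Bool // ¬ lt x.1} with hHb
  set g : Hb × (Fin (s+s) → Λ) → Fin (s+s) → Fin n × Bool := fun σ k => (σ.2 k).1 with hgd
  set V : Finset (Hb × (Fin (s+s) → Λ)) :=
    Finset.univ.filter fun σ => Function.Injective (fun k => (σ.2 k).1.1) with hV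
  have ok : ∀ σ ∈ V, SnakeOK lt σ.1.1 (g σ) := fun σ hσ =>
    ⟨hs1, σ.1.2, fun k => (σ.2 k).2, (Finset.mem_filter.mp hσ).2⟩
  set ω : Hb × (Fin (s+s) → Λ) → ℝ := fun σ => κ ^ 2 / ξ σ.1 ^ 2 with hω
  have hω0 : ∀ σ, 0 ≤ ω σ := fun σ => by simp only [hω]; positivity
  set E : Hb × (Fin (s+s) → Λ) → Fin (s+1) ⊕ Fin (s+1) → Finset ((Fin n × Bool) × (Fin n × Bool)) :=
    fun σ i => Ev (ssrc σ.1.1 (g σ) i) (stgt σ.1.1 (g σ) i) with hE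
  set Q : Hb × (Fin (s+s) → Λ) → ℝ := fun σ => ∏ i, ((m:ℝ) * wt w (E σ i)) with hQ
  have hQ0 : ∀ σ, 0 ≤ Q σ := fun σ => Finset.prod_nonneg fun i _ =>
    mul_nonneg (Nat.cast_nonneg _) (wt_nonneg hw0 _)
  set X : (Fin m → (Fin n × Bool) × (Fin n × Bool)) → ℝ :=
    fun Φ => ∑ σ ∈ V, ω σ * ∏ i, cnt (E σ i) Φ with hX
  set F := ∑ σ ∈ V, ω σ * Q σ with hF
  set ρ := (m.descFactorial (2*s+2) : ℝ) / (m:ℝ) ^ (2*s+2) with hρ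
  have hcard : Fintype.card (Fin (s+1) ⊕ Fin (s+1)) = 2*s+2 := by simp; omega
  have hX0 : ∀ Φ, 0 ≤ X Φ := fun Φ => Finset.sum_nonneg fun σ _ => mul_nonneg (hω0 σ)
    (Finset.prod_nonneg fun i _ => cnt_nonneg _ _)
  -- first moment
  have e1 : Ex m w X = ρ * F := by
    simp only [hX]
    rw [Ex_sum, hF, Finset.mul_sum]
    refine Finset.sum_congr rfl fun σ hσ => ?_
    rw [Ex_mul_left, first_moment hw1 (E σ) (fun i j hij => (ok σ hσ).Ev_disjoint i j hij), hcard]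
    simp only [hQ]
    rw [Finset.prod_mul_distrib, Finset.prod_const, Finset.card_univ, hcard, hρ]
    field_simp
  -- second moment
  have e2 : Ex m w (fun Φ => X Φ ^ 2) ≤ F * (κ ^ 2 * Z) := by
    have r1 : (fun Φ => X Φ ^ 2) = fun Φ => ∑ σ ∈ V, ∑ τ ∈ V, (ω σ * ω τ) *
        ((∏ i, cnt (E σ i) Φ) * ∏ i, cnt (E τ i) Φ) := by
      funext Φ
      simp only [hX]
      rw [sq, Finset.sum_mul_sum]
      refine Finset.sum_congr rfl fun σ _ => Finset.sum_congr rfl fun τ _ => by ring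
    rw [r1, Ex_sum, hF, Finset.sum_mul]
    refine Finset.sum_le_sum fun σ hσ => ?_
    rw [Ex_sum]
    set M : Fin n × Bool → Fin n × Bool → ℝ :=
      fun y z => μ * ξ y * ξ z + BB σ.1.1 (g σ) y z with hM
    have hM0 : ∀ y z, 0 ≤ M y z := fun y z => by
      have := hξ y; have := hξ z; have := BB_nonneg σ.1.1 (g σ) y z
      simp only [hM]; positivity
    have step : ∀ τ ∈ V, Ex m w (fun Φ => (ω σ * ω τ) *
        ((∏ i, cnt (E σ i) Φ) * ∏ i, cnt (E τ i) Φ)) ≤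
        (ω σ * Q σ) * (ω τ * ∏ i, M (ssrc τ.1.1 (g τ) i) (stgt τ.1.1 (g τ) i)) := by
      intro τ hτ
      rw [Ex_mul_left]
      have h1 := second_moment (m := m) hw0 hw1 (E σ) (E τ)
        (fun i j hij => (ok σ hσ).Ev_disjoint i j hij) (ok σ hσ).Ev_inj
        (fun i j hij => (ok τ hτ).Ev_disjoint i j hij) (fun i k => Ev_eq_or_disj _ _ _ _)
      have h2 : ∏ k, ((m:ℝ) * wt w (E τ k) + if ∃ i, E σ i = E τ k then (1:ℝ) else 0) ≤
          ∏ i, M (ssrc τ.1.1 (g τ) i) (stgt τ.1.1 (g τ) i) := by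
        refine Finset.prod_le_prod (fun k _ => ?_) (fun k _ => ?_)
        · have := wt_nonneg hw0 (E τ k)
          split_ifs <;> positivity
        · have a1 := m_wt_le (m := m) hg (ssrc τ.1.1 (g τ) k) (stgt τ.1.1 (g τ) k)
          rw [← hμ] at a1
          exact add_le_add a1 (le_of_eq rfl)
      have h3 := h1.trans (mul_le_mul_of_nonneg_left h2 (hQ0 σ))
      have h4 := mul_le_mul_of_nonneg_left h3 (mul_nonneg (hω0 σ) (hω0 τ))
      refine h4.trans (le_of_eq ?_)
      simp only [hQ]
      ring
    refine (Finset.sum_le_sum step).trans ?_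
    rw [← Finset.mul_sum]
    refine mul_le_mul_of_nonneg_left ?_ (mul_nonneg (hω0 σ) (hQ0 σ))
    have hall : ∑ τ ∈ V, ω τ * ∏ i, M (ssrc τ.1.1 (g τ) i) (stgt τ.1.1 (g τ) i) ≤
        ∑ τ, ω τ * ∏ i, M (ssrc τ.1.1 (g τ) i) (stgt τ.1.1 (g τ) i) :=
      Finset.sum_le_sum_of_subset_of_nonneg (Finset.subset_univ _) fun τ _ _ =>
        mul_nonneg (hω0 τ) (Finset.prod_nonneg fun i _ => hM0 _ _)
    refine hall.trans ?_
    rw [Fintype.sum_prod_type]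
    refine le_trans (le_of_eq ?_) (hZb (ok σ hσ))
    refine Finset.sum_congr rfl fun h' _ => ?_
    rw [← sum_snake, Finset.mul_sum]
  -- lower bound on F
  have e3 : κ ^ 2 * (μ ^ 2 * H2 * ((μ * (θ - 4 * s * κ ^ 2)) ^ s) ^ 2) ≤ F := by
    have r1 : F = ∑ h : Hb, ∑ f : Fin (s+s) → Λ, κ ^ 2 * μ ^ (2*s+2) * ξ h ^ 2 *
        (if Function.Injective (fun k => (f k).1.1) then ∏ k, ξ (f k) ^ 2 else 0) := by
      rw [hF, hV, Finset.sum_filter, Fintype.sum_prod_type]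
      refine Finset.sum_congr rfl fun h _ => Finset.sum_congr rfl fun f _ => ?_
      by_cases hi : Function.Injective (fun k => (f k).1.1)
      · rw [if_pos hi, if_pos hi]
        have hok := ok (h, f) (Finset.mem_filter.mpr ⟨Finset.mem_univ _, hi⟩)
        have q1 : Q (h, f) = ∏ i, (μ * ξ (ssrc h.1 (g (h,f)) i) * ξ (stgt h.1 (g (h,f)) i)) := by
          simp only [hQ]
          refine Finset.prod_congr rfl fun i _ => ?_
          have := m_wt (m := m) hg (hok.noLoop i)
          rw [← hμ] at this
          exact this
        rw [q1, prod_snake]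
        have := hξ h.1
        have hh : ξ (lneg h.1) = ξ h.1 := rfl
        simp only [hω, hgd, hh]
        field_simp
      · rw [if_neg hi, if_neg hi, mul_zero]
    have d := distinct_sum (fun x : Λ => x.1.1) (fun x : Λ => ξ x ^ 2) (fun x => sq_nonneg _)
      (c0 := 2 * κ ^ 2) (b := 4 * s * κ ^ 2) (fun t => ?_) (by positivity) (by rw [← hθ]; exact hb)
      (s+s) (by push_cast; linarith)
    · rw [← hθ] at d
      rw [r1]
      simp_rw [← Finset.mul_sum]
      rw [← Finset.sum_mul, ← Finset.mul_sum, ← hH]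
      have hH0 : 0 ≤ H2 := by rw [hH]; exact Finset.sum_nonneg fun x _ => sq_nonneg _
      have := mul_le_mul_of_nonneg_left d (by positivity : 0 ≤ κ ^ 2 * μ ^ (2*s+2) * H2)
      refine le_trans (le_of_eq ?_) (this.trans (le_of_eq ?_))
      · rw [mul_pow]; ring
      · congr!
    · suffices hsuf : ∑ x : Λ, (if x.1.1 = t then ξ x ^ 2 else 0) ≤ 2 * κ ^ 2 by
        refine le_trans (le_of_eq ?_) hsuf
        congr!
      rw [← Finset.sum_filter]
      have hle : ∀ x ∈ (Finset.univ.filter fun x : Λ => x.1.1 = t), ξ x ^ 2 ≤ κ ^ 2 := fun x _ =>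
        pow_le_pow_left₀ (hξ x).le (hκl x.1 x.2) 2
      refine (Finset.sum_le_card_nsmul _ _ _ hle).trans ?_
      rw [nsmul_eq_mul]
      refine mul_le_mul_of_nonneg_right ?_ (by positivity)
      have : ((Finset.univ.filter fun x : Λ => x.1.1 = t).image
          (fun x => x.1)) ⊆ ({(t, true), lneg (t, true)} : Finset (Fin n × Bool)) := by
        intro y hy
        obtain ⟨x, hx, rfl⟩ := Finset.mem_image.mp hy
        have := eq_or_lneg (b := (t, true)) (Finset.mem_filter.mp hx).2
        simpa using this
      have h2 := (Finset.card_le_card this).trans Finset.card_le_two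
      rw [Finset.card_image_of_injective _ Subtype.val_injective] at h2
      exact_mod_cast h2
  -- positivity implies unsat
  have e4 : Ex m w (fun Φ => if 0 < X Φ then 1 else 0) ≤ 1 - probSat2 n m p := by
    rw [probSat_compl hg, sub_sub_cancel]
    refine Ex_mono hw0 fun Φ _ => ?_
    by_cases hx : 0 < X Φ
    · rw [if_pos hx]
      have : ∃ σ ∈ V, 0 < ω σ * ∏ i, cnt (E σ i) Φ := by
        by_contra hc
        push Not at hc
        exact absurd hx (not_lt.mpr (Finset.sum_nonpos hc))
      obtain ⟨σ, hσ, h1⟩ := this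
      have h2 : ∀ i, 0 < cnt (E σ i) Φ := by
        intro i
        refine lt_of_le_of_ne (cnt_nonneg _ _) fun h0 => ?_
        rw [Finset.prod_eq_zero (Finset.mem_univ i) h0.symm, mul_zero] at h1
        exact lt_irrefl _ h1
      rw [if_neg (snake_unsat _ _ h2)]
    · rw [if_neg hx]
      split_ifs <;> norm_num
  have hF0 : 0 ≤ F := Finset.sum_nonneg fun σ _ => mul_nonneg (hω0 σ) (hQ0 σ)
  have e5 := cauchy_pos hw0 X hX0
  rw [e1] at e5
  have hP0 : 0 ≤ Ex m w (fun Φ => if 0 < X Φ then (1:ℝ) else 0) := by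
    refine (Ex_zero (m := m) (w := w)).symm.le.trans ?_
    exact Ex_mono hw0 fun Φ _ => by split_ifs <;> norm_num
  have hP : 0 ≤ 1 - probSat2 n m p := hP0.trans e4
  have hH0 : 0 ≤ H2 := by rw [hH]; exact Finset.sum_nonneg fun x _ => sq_nonneg _
  have hθ0 : 0 ≤ θ := by rw [hθ]; exact Finset.sum_nonneg fun x _ => sq_nonneg _
  have hn : 0 < n := by
    rcases Nat.eq_zero_or_pos n with rfl | h
    · have := hg.sum1; simp at this
    · exact h
  have hℓ0 : 0 ≤ ℓ := le_trans (sq_nonneg _) (hℓ (⟨0, hn⟩, true))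
  have hZ0 : 0 ≤ Z := by rw [hZ]; positivity
  have e6 : (ρ * F) ^ 2 ≤ (1 - probSat2 n m p) * (F * (κ ^ 2 * Z)) :=
    e5.trans (mul_le_mul e4 e2 (by
      rw [← Ex_zero (m := m) (w := w)]
      exact Ex_mono hw0 fun Φ _ => sq_nonneg _) hP)
  set L := μ ^ 2 * H2 * ((μ * (θ - 4 * s * κ ^ 2)) ^ s) ^ 2 with hL
  have hL0 : 0 ≤ L := by rw [hL]; positivity
  have hκ2 : 0 < κ ^ 2 := by positivity
  rcases hF0.eq_or_lt with hz | hpos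
  · have : L ≤ 0 := by
      by_contra hc
      push Not at hc
      have := mul_pos hκ2 hc
      linarith
    have : L = 0 := le_antisymm this hL0
    rw [this, mul_zero]
    positivity
  · have e7 : ρ ^ 2 * F ≤ (1 - probSat2 n m p) * (κ ^ 2 * Z) := by
      refine le_of_mul_le_mul_right ?_ hpos
      linarith
    have e8 := mul_le_mul_of_nonneg_left e3 (sq_nonneg ρ)
    refine le_of_mul_le_mul_right ?_ hκ2
    linarith

end Core2

section Numer

lemma numA {P ρ a b c N L A D : ℝ} (hP0 : 0 ≤ P) (hP1 : P ≤ 1) (hρ : 1 - a ≤ ρ) (ha : 0 ≤ a)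
    (hb0 : 0 ≤ b) (hN : 0 < N) (hA : 0 < A) (hc0 : 0 ≤ c) (hL : (1 - b) * N ≤ L) (hD : D ≤ c * A)
    (h : ρ ^ 2 * (A * L) ≤ P * (N * (A + D))) : 1 - 2 * a - b - c ≤ P := by
  rcases le_or_gt b 1 with hb | hb
  · have h1 : 1 - 2 * a ≤ ρ ^ 2 := by nlinarith [sq_nonneg (ρ - 1)]
    have h2 : ρ ^ 2 * (A * ((1 - b) * N)) ≤ ρ ^ 2 * (A * L) := by gcongr
    have h3 : P * (N * (A + D)) ≤ P * (N * (A + c * A)) := by gcongr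
    have h4 : (ρ ^ 2 * (1 - b)) * (A * N) ≤ (P * (1 + c)) * (A * N) := by linarith
    have h5 := le_of_mul_le_mul_right h4 (by positivity)
    have h6 : (1 - 2 * a) * (1 - b) ≤ ρ ^ 2 * (1 - b) :=
      mul_le_mul_of_nonneg_right h1 (by linarith)
    have h7 : 0 ≤ a * b := by positivity
    have h8 : P * c ≤ 1 * c := by gcongr
    linarith
  · linarith

lemma rho_bound {m : ℕ} (hm : 1 ≤ m) (N : ℕ) :
    1 - (N:ℝ) ^ 2 / m ≤ (m.descFactorial N : ℝ) / (m:ℝ) ^ N := by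
  have hm0 : (0:ℝ) < m := by exact_mod_cast hm
  rcases le_or_gt N m with h | h
  · have h1 := Nat.pow_sub_le_descFactorial m N
    have h2 : ((m:ℝ) - N) ^ N ≤ m.descFactorial N := by
      have h3 : (((m + 1 - N : ℕ) : ℝ)) ^ N ≤ m.descFactorial N := by exact_mod_cast h1
      refine le_trans (pow_le_pow_left₀ ?_ ?_ N) h3
      · have : (N:ℝ) ≤ m := by exact_mod_cast h
        linarith
      · rw [Nat.cast_sub (by omega)]; push_cast; linarith
    have hNm : (N:ℝ) / m ≤ 1 := by rw [div_le_one hm0]; exact_mod_cast h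
    have h4 := one_add_mul_le_pow (a := -((N:ℝ) / m)) (by linarith) N
    have h5 : (1 + -((N:ℝ) / m)) ^ N = ((m:ℝ) - N) ^ N / (m:ℝ) ^ N := by
      rw [← div_pow]; congr 1; field_simp; ring
    rw [h5] at h4
    have h6 : ((m:ℝ) - N) ^ N / (m:ℝ) ^ N ≤ (m.descFactorial N : ℝ) / (m:ℝ) ^ N := by gcongr
    have h7 : 1 + (N:ℝ) * -((N:ℝ) / m) = 1 - (N:ℝ) ^ 2 / m := by ring
    linarith
  · have h1 : (1:ℝ) ≤ (N:ℝ) ^ 2 / m := by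
      rw [le_div_iff₀ hm0]
      have : (m:ℝ) ≤ N := by exact_mod_cast h.le
      have : (1:ℝ) ≤ m := by exact_mod_cast hm
      nlinarith
    have h2 : (0:ℝ) ≤ (m.descFactorial N : ℝ) / (m:ℝ) ^ N := by positivity
    linarith

lemma ratio {θ u v μ : ℝ} (s : ℕ) (hθ : 0 < θ) (hu : 0 ≤ u) (huθ : u ≤ θ) (hv : 0 ≤ v) (hμ : 0 ≤ μ) :
    (1 - 2 * s * (u + v) / θ) * ((μ * (θ + v)) ^ s) ^ 2 ≤ ((μ * (θ - u)) ^ s) ^ 2 := by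
  have hx1 : (u + v) / (θ + v) ≤ 1 := by rw [div_le_one (by positivity)]; linarith
  have h1 := one_add_mul_le_pow (a := -((u + v) / (θ + v))) (by linarith) (s * 2)
  have h2 : μ * (θ - u) = (μ * (θ + v)) * (1 + -((u + v) / (θ + v))) := by field_simp; ring
  have h6 : ((μ * (θ - u)) ^ s) ^ 2 =
      ((μ * (θ + v)) ^ s) ^ 2 * (1 + -((u + v) / (θ + v))) ^ (s * 2) := by
    rw [h2, mul_pow (μ * (θ + v)), mul_pow ((μ * (θ + v)) ^ s), ← pow_mul (1 + -((u + v) / (θ + v)))]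
  rw [h6, mul_comm]
  refine mul_le_mul_of_nonneg_left (le_trans ?_ h1) (by positivity)
  have h3 : (u + v) / (θ + v) ≤ (u + v) / θ := by gcongr; linarith
  have h4 : (s:ℝ) * 2 * ((u + v) / (θ + v)) ≤ s * 2 * ((u + v) / θ) := by gcongr
  have h5 : 2 * (s:ℝ) * (u + v) / θ = s * 2 * ((u + v) / θ) := by ring
  rw [h5]; push_cast; linarith

lemma exps {r : ℝ} (hr : 1 < r) : ∃ s0 : ℕ, ∀ s ≥ s0, (s:ℝ) ^ 4 ≤ r ^ s := by
  have h := (isLittleO_pow_const_const_pow_of_one_lt (R := ℝ) 4 hr).bound (c := 1) one_pos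
  obtain ⟨s0, hs⟩ := Filter.eventually_atTop.mp h
  refine ⟨s0, fun s hss => ?_⟩
  have := hs s hss
  rw [one_mul, Real.norm_of_nonneg (by positivity), Real.norm_of_nonneg (by positivity)] at this
  exact this

lemma xi_sum_sub {n : ℕ} {p : ℕ → ℝ} (hg : GoodP n p) {k : ℕ} (hk : k ≤ n) :
    ∑ x : {x : Fin n × Bool // ¬ (k ≤ (x.1 : ℕ))}, xiL n p x ^ 2 =
      ∑ i ∈ Finset.range k, p i ^ 2 / ∑ i ∈ Finset.range n, p i ^ 2 := by
  have hS := hg.Spos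
  set S := ∑ i ∈ Finset.range n, p i ^ 2 with hSd
  rw [← Finset.sum_subtype (Finset.univ.filter fun x : Fin n × Bool => ¬ (k ≤ (x.1 : ℕ)))
    (by simp) (fun x => xiL n p x ^ 2), Finset.sum_filter, Fintype.sum_prod_type]
  have : ∀ i : Fin n, ∑ y : Bool, (if ¬ (k ≤ (i : ℕ)) then xiL n p (i, y) ^ 2 else 0) =
      (fun i : ℕ => if ¬ (k ≤ i) then p i ^ 2 / S else 0) i := by
    intro i
    have h1 : ∀ y, xiL n p (i, y) ^ 2 = p i ^ 2 / (2 * S) := fun y => by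
      simp only [xiL]
      rw [div_pow, Real.sq_sqrt (by positivity)]
    simp only [h1, Fintype.sum_bool]
    split_ifs
    · simp
    · field_simp; ring
  rw [Finset.sum_congr rfl fun i _ => this i, Fin.sum_univ_eq_sum_range
    (fun i : ℕ => if ¬ (k ≤ i) then p i ^ 2 / S else 0), ← Finset.sum_filter]
  refine Finset.sum_congr ?_ fun _ _ => rfl
  ext i; simp; omega

lemma xi_sum_all {n : ℕ} {p : ℕ → ℝ} (hg : GoodP n p) : ∑ x, xiL n p x ^ 2 = 1 := by
  have hS := hg.Spos
  rw [Fintype.sum_prod_type]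
  have : ∀ i : Fin n, ∑ y : Bool, xiL n p (i, y) ^ 2 =
      (fun i : ℕ => p i ^ 2 / ∑ i ∈ Finset.range n, p i ^ 2) i := by
    intro i
    have h1 : ∀ y, xiL n p (i, y) ^ 2 = p i ^ 2 / (2 * ∑ i ∈ Finset.range n, p i ^ 2) := fun y => by
      simp only [xiL]
      rw [div_pow, Real.sq_sqrt (by positivity)]
    simp only [h1, Fintype.sum_bool]
    field_simp; ring
  rw [Finset.sum_congr rfl fun i _ => this i, Fin.sum_univ_eq_sum_range
    (fun i : ℕ => p i ^ 2 / ∑ i ∈ Finset.range n, p i ^ 2), ← Finset.sum_div, div_self hS.ne']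

lemma xi_sum_one {n : ℕ} {p : ℕ → ℝ} (hg : GoodP n p) :
    ∑ x, xiL n p x = 2 / √(2 * ∑ i ∈ Finset.range n, p i ^ 2) := by
  rw [Fintype.sum_prod_type]
  simp only [xiL, Fintype.sum_bool, ← two_mul]
  rw [← Finset.mul_sum, ← Finset.sum_div, hg.sum1]
  ring

end Numer

section PartTwo

set_option maxHeartbeats 1000000 in
/-- quantitative unsatisfiability above the threshold -/
lemma partTwo {ε : ℝ} (hε : 0 < ε) (hε1 : ε ≤ 1) : ∃ l0 > (0:ℝ), ∃ K : ℝ, ∀ (n m : ℕ) (p : ℕ → ℝ),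
    GoodP n p → (∀ i j, i ≤ j → j < n → p j ≤ p i) →
    p 0 ^ 2 / (∑ i ∈ Finset.range n, p i ^ 2) ≤ l0 →
    ∑ i ∈ Finset.range n, p i ^ 2 ≤ 1 / 4 →
    1 + ε ≤ m * ∑ i ∈ Finset.range n, p i ^ 2 →
    m * ∑ i ∈ Finset.range n, p i ^ 2 ≤ 1 + ε + ∑ i ∈ Finset.range n, p i ^ 2 →
    probSat2 n m p ≤ K * √(p 0 ^ 2 / ∑ i ∈ Finset.range n, p i ^ 2) := by
  obtain ⟨s0, hs0⟩ := exps (r := 1 + ε / 3) (by linarith)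
  set C := 4 * (1 + 6 / ε) ^ 2 + 12 with hC
  refine ⟨min (ε / 12) (1 / ((s0:ℝ) + 3) ^ 4), by positivity,
    1024 + 64 * (1 + 3 / ε) + 4 * C ^ 2 / ε, ?_⟩
  intro n m p hg hsort hl hS4 hm1 hm2
  have hS := hg.Spos
  set S := ∑ i ∈ Finset.range n, p i ^ 2 with hSd
  set l := p 0 ^ 2 / S with hld
  have hl1 : l ≤ ε / 12 := hl.trans (min_le_left _ _)
  have hl2 : l ≤ 1 / ((s0:ℝ) + 3) ^ 4 := hl.trans (min_le_right _ _)
  have hl0 : 0 ≤ l := by positivity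
  have hn : 0 < n := by
    rcases Nat.eq_zero_or_pos n with rfl | h
    · have := hg.sum1; simp at this
    · exact h
  have hpos : ∀ i, i < n → 0 < p i := fun i hi => hg.pos ⟨i, hi⟩
  -- choice of k
  set G : ℕ → ℝ := fun k => ∑ i ∈ Finset.range k, p i ^ 2 / S with hG
  have hGn : G n = 1 := by
    simp only [hG]; rw [← Finset.sum_div, ← hSd, div_self hS.ne']
  have hex : ∃ k, ε / 4 ≤ G k := ⟨n, by rw [hGn]; linarith⟩
  set k := Nat.find hex with hk
  have hk1 : ε / 4 ≤ G k := Nat.find_spec hex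
  have hkn' : k ≤ n := Nat.find_min' hex (by rw [hGn]; linarith)
  have hk2 : G k ≤ ε / 4 + l := by
    have hk0 : k ≠ 0 := by
      intro h0
      rw [h0] at hk1
      simp [hG] at hk1
      linarith
    obtain ⟨j, hj⟩ := Nat.exists_eq_succ_of_ne_zero hk0
    have h1 : ¬ (ε / 4 ≤ G j) := Nat.find_min hex (by omega)
    have h2 : G k = G j + p j ^ 2 / S := by
      rw [hj]; simp only [hG]; exact Finset.sum_range_succ _ _
    have h3 : p j ^ 2 / S ≤ l := by
      rw [hld]
      have := pow_le_pow_left₀ (hpos j (by omega)).le (hsort 0 j (by omega) (by omega)) 2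
      gcongr
    push Not at h1
    linarith
  have hkn : k < n := by
    refine lt_of_le_of_ne hkn' fun h => ?_
    rw [h, hGn] at hk2
    linarith
  -- parameters
  set κ := p k / √(2 * S) with hκ
  have hpk := hpos k hkn
  have hκ0 : 0 < κ := by positivity
  set lt : Fin n → Prop := fun i => k ≤ (i:ℕ) with hlt
  set θ := ∑ x : {x : Fin n × Bool // lt x.1}, xiL n p x ^ 2 with hθ
  set H2 := ∑ x : {x : Fin n × Bool // ¬ lt x.1}, xiL n p x ^ 2 with hH
  have hHG : H2 = G k := xi_sum_sub hg hkn'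
  have hθH : θ + H2 = 1 := by
    rw [← xi_sum_all hg]
    exact Fintype.sum_subtype_add_sum_subtype (fun x : Fin n × Bool => lt x.1) (fun x => xiL n p x ^ 2)
  have hθ2 : 1 / 2 ≤ θ := by linarith
  have hκl : ∀ x : Fin n × Bool, lt x.1 → xiL n p x ≤ κ := by
    intro x hx
    simp only [xiL, hκ]
    have := hsort k x.1 hx x.1.2
    gcongr
  have hκh : ∀ x : Fin n × Bool, ¬ lt x.1 → κ ≤ xiL n p x := by
    intro x hx
    simp only [xiL, hκ]
    have := hsort x.1 k (not_le.mp hx).le hkn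
    gcongr
  have hsq : ∀ i, (p i / √(2 * S)) ^ 2 = p i ^ 2 / (2 * S) := fun i => by
    rw [div_pow, Real.sq_sqrt (by positivity)]
  have hℓ : ∀ x, xiL n p x ^ 2 ≤ l / 2 := by
    intro x
    simp only [xiL]
    rw [← hSd, hsq, hld]
    have := pow_le_pow_left₀ (hpos x.1 x.1.2).le (hsort 0 x.1 (by omega) x.1.2) 2
    rw [div_div, mul_comm S 2]
    gcongr
  have hκ2 : κ ^ 2 ≤ l / 2 := hℓ (⟨k, hkn⟩, true)
  -- S ≤ 8 κ²
  have hSκ : S ≤ 8 * κ ^ 2 := by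
    have h1 : θ ≤ κ * (2 / √(2 * S)) := by
      rw [hSd, ← xi_sum_one hg, Finset.mul_sum]
      have h2 : θ ≤ ∑ x : {x : Fin n × Bool // lt x.1}, κ * xiL n p x := by
        rw [hθ]
        refine Finset.sum_le_sum fun x _ => ?_
        rw [sq]
        exact mul_le_mul_of_nonneg_right (hκl x x.2) (xiL_pos hg _).le
      have h3 : 0 ≤ ∑ x : {x : Fin n × Bool // ¬ lt x.1}, κ * xiL n p x :=
        Finset.sum_nonneg fun x _ => mul_nonneg hκ0.le (xiL_pos hg _).le
      have h4 := Fintype.sum_subtype_add_sum_subtype (fun x : Fin n × Bool => lt x.1)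
        (fun x => κ * xiL n p x)
      linarith
    have hr : 0 < √(2 * S) := by positivity
    have h5 : √(2 * S) / 2 ≤ 2 * κ := by
      have : θ * √(2 * S) ≤ 2 * κ := by
        have := mul_le_mul_of_nonneg_right h1 hr.le
        have h6 : κ * (2 / √(2 * S)) * √(2 * S) = 2 * κ := by field_simp
        linarith
      have := mul_le_mul_of_nonneg_right hθ2 hr.le
      linarith
    have h7 := pow_le_pow_left₀ (by positivity) h5 2
    rw [div_pow, Real.sq_sqrt (by positivity)] at h7
    linarith
  -- q = √κ and s
  set q := √κ with hq
  have hq0 : 0 < q := Real.sqrt_pos.mpr hκ0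
  have hqκ : q ^ 2 = κ := Real.sq_sqrt hκ0.le
  have hq3 : q ≤ 1 / ((s0:ℝ) + 3) := by
    refine le_of_pow_le_pow_left₀ (n := 4) (by norm_num) (by positivity) ?_
    have : q ^ 4 = κ ^ 2 := by rw [← hqκ]; ring
    rw [this, one_div_pow]
    linarith
  have hq1 : q ≤ 1 / 3 := hq3.trans (by gcongr; linarith [(Nat.cast_nonneg s0 : (0:ℝ) ≤ s0)])
  set s := ⌈1 / q⌉₊ with hs
  have hsq1 : 1 ≤ s * q := by
    have := Nat.le_ceil (1 / q)
    rw [div_le_iff₀ hq0] at this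
    exact this
  have hsq2 : s * q ≤ 2 := by
    have := (Nat.ceil_lt_add_one (by positivity : 0 ≤ 1 / q)).le
    have := mul_le_mul_of_nonneg_right this hq0.le
    have h6 : (1 / q + 1) * q = 1 + q := by field_simp
    linarith
  have hss0 : s0 ≤ s := by
    have : (s0:ℝ) + 3 ≤ s := by
      rw [le_div_iff₀ (by positivity)] at hq3
      refine le_of_mul_le_mul_right ?_ hq0
      linarith
    have : (s0:ℝ) ≤ s := by linarith
    exact_mod_cast this
  have hs1 : 1 ≤ s := by
    rw [Nat.one_le_iff_ne_zero]
    intro h0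
    rw [h0] at hsq1
    norm_num at hsq1
  have hs1' : (1:ℝ) ≤ s := by exact_mod_cast hs1
  have hsκ : (s:ℝ) ^ 2 * κ ≤ 4 := by
    have : (s:ℝ) ^ 2 * κ = (s * q) ^ 2 := by rw [← hqκ]; ring
    rw [this]
    refine (pow_le_pow_left₀ (by linarith) hsq2 2).trans ?_
    norm_num
  have hsκ1 : 1 ≤ (s:ℝ) ^ 4 * κ ^ 2 := by
    have : (s:ℝ) ^ 4 * κ ^ 2 = (s * q) ^ 4 := by rw [← hqκ]; ring
    rw [this]; exact one_le_pow₀ hsq1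
  -- μ
  set μ := (m:ℝ) * (1 - S)⁻¹ * S with hμ
  have hS1 : 0 < 1 - S := by linarith
  have hμ' : μ * (1 - S) = m * S := by rw [hμ]; field_simp
  have hμ0 : 0 ≤ μ := by positivity
  have hμ1 : 1 + ε ≤ μ := by
    have := mul_nonneg hμ0 hS.le
    linarith
  have hμ4 : μ ≤ 4 := by
    have := mul_le_mul_of_nonneg_left hS4 hμ0
    linarith
  have hν : 1 + ε / 3 ≤ μ * θ := by
    have h1 := mul_le_mul hμ1 (show 1 - ε / 3 ≤ θ by linarith) (by linarith) hμ0
    have h2 := mul_le_mul_of_nonneg_left hε1 hε.le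
    linarith
  set Kc := 1 / (μ * θ - 1) with hKc
  have hν1 : 0 < μ * θ - 1 := by linarith
  have hKc0 : 0 ≤ Kc := by positivity
  have hKc3 : Kc ≤ 3 / ε := by
    rw [hKc, div_le_div_iff₀ hν1 hε]; linarith
  have hK : μ * θ * Kc = 1 + Kc := by rw [hKc]; field_simp; ring
  have hbig : 1 ≤ (μ * θ) ^ s * κ ^ 2 := by
    refine hsκ1.trans ?_
    have h1 := (hs0 s hss0).trans (pow_le_pow_left₀ (by positivity) hν s)
    gcongr
  have hb : 4 * s * κ ^ 2 ≤ θ := by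
    have h1 : 4 * s * κ ^ 2 = 4 * (s * q) * q ^ 3 := by rw [← hqκ]; ring
    have h2 : q ^ 3 ≤ (1 / 3) ^ 3 := pow_le_pow_left₀ hq0.le hq1 3
    have h3 : 4 * (s * q) * q ^ 3 ≤ 4 * 2 * (1 / 3) ^ 3 := by gcongr
    rw [h1]
    linarith
  have hm : 1 ≤ m := by
    rw [Nat.one_le_iff_ne_zero]
    intro h0
    rw [h0] at hm1
    norm_num at hm1
    linarith
  have hmr : (0:ℝ) < m := by exact_mod_cast hm
  have core := core hg hs1 hm lt hμ hκ0 hKc0 hκl hκh hℓ (hθ.trans (by congr!)) (hH.trans (by congr!)) hK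
    hbig hb
  -- final
  have hP0 : 0 ≤ 1 - probSat2 n m p := by
    rw [probSat_compl hg, sub_sub_cancel]
    refine (Ex_zero (m := m) (w := clauseProb2 n p)).symm.le.trans ?_
    exact Ex_mono (clauseProb_nonneg hg) fun Φ _ => by split_ifs <;> norm_num
  have hP1 : 1 - probSat2 n m p ≤ 1 := by linarith [probSat_nonneg (m := m) hg]
  have hθ0 : 0 < θ := by linarith
  have hμp : 0 < μ := by linarith
  have hH0 : 0 < H2 := by linarith
  clear_value θ H2 μ Kc q s κ l C
  have fin := numA (a := 512 * κ) (b := 2 * s * (4 * s * κ ^ 2 + 4 * s * Kc * κ ^ 2) / θ)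
    (c := 4 * C ^ 2 * l / ε) hP0 hP1
    (le_trans ?_ (rho_bound hm (2 * s + 2))) (by positivity) (by positivity)
    (by positivity) (by positivity) (by positivity)
    (ratio s hθ0 (by positivity) hb (by positivity) hμ0) ?_ core
  · have hbb : 2 * s * (4 * s * κ ^ 2 + 4 * s * Kc * κ ^ 2) / θ ≤ 64 * (1 + 3 / ε) * κ := by
      rw [div_le_iff₀ hθ0]
      have h1 : 2 * s * (4 * s * κ ^ 2 + 4 * s * Kc * κ ^ 2) = 8 * (s ^ 2 * κ) * (κ * (1 + Kc)) := by
        ring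
      rw [h1]
      have h2 : 8 * (s ^ 2 * κ) * (κ * (1 + Kc)) ≤ 8 * 4 * (κ * (1 + 3 / ε)) := by gcongr
      have h3 : 0 ≤ κ * (1 + 3 / ε) := by positivity
      have h4 := mul_le_mul_of_nonneg_left hθ2 h3
      linarith
    have hκl' : κ ≤ √l := by
      refine Real.le_sqrt_of_sq_le ?_
      linarith
    have hll : l ≤ √l := by
      refine Real.le_sqrt_of_sq_le ?_
      have := mul_le_mul_of_nonneg_left (show l ≤ 1 by linarith) hl0
      linarith
    have h3 : 0 ≤ 64 * (1 + 3 / ε) := by positivity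
    have h4 := mul_le_mul_of_nonneg_left hκl' h3
    have h5 := mul_le_mul_of_nonneg_left hll (by positivity : 0 ≤ 4 * C ^ 2 / ε)
    have h6 : 4 * C ^ 2 * l / ε = 4 * C ^ 2 / ε * l := by ring
    rw [h6] at fin
    linarith
  · have h1 : ((2 * s + 2 : ℕ) : ℝ) ^ 2 / m ≤ 512 * κ := by
      rw [div_le_iff₀ hmr]
      push_cast
      have h2 : (2 * (s:ℝ) + 2) ^ 2 ≤ (4 * s) ^ 2 := pow_le_pow_left₀ (by positivity) (by linarith) 2
      have h3 : 1 ≤ m * (8 * κ ^ 2) := by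
        have := mul_le_mul_of_nonneg_left hSκ hmr.le
        linarith
      have h4 : (4 * (s:ℝ)) ^ 2 * 1 ≤ (4 * s) ^ 2 * (m * (8 * κ ^ 2)) := by gcongr
      have h5 : (s:ℝ) ^ 2 * κ * (128 * κ * m) ≤ 4 * (128 * κ * m) := by gcongr
      linarith
    linarith
  · have h1 : μ * (1 + 2 * Kc) ^ 2 + 2 * μ + 4 ≤ C := by
      have : 1 + 2 * Kc ≤ 1 + 6 / ε := by
        have : 6 / ε = 2 * (3 / ε) := by ring
        linarith
      have : μ * (1 + 2 * Kc) ^ 2 ≤ 4 * (1 + 6 / ε) ^ 2 := by gcongr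
      rw [hC]; linarith
    have h2 : 2 * (μ * (1 + 2 * Kc) ^ 2 + 2 * μ + 4) ^ 2 * (l / 2) ≤ 2 * C ^ 2 * (l / 2) := by
      gcongr
    refine h2.trans ?_
    have h3 : 1 * (ε / 4) ≤ μ ^ 2 * H2 := by
      have : 1 ≤ μ ^ 2 := one_le_pow₀ (by linarith)
      rw [hHG]
      gcongr
    have h4 := mul_le_mul_of_nonneg_left h3 (by positivity : 0 ≤ 4 * C ^ 2 * l / ε)
    refine le_trans (le_of_eq ?_) h4
    field_simp

end PartTwo

/-- Non-uniform random 2-SAT with `p₁² = o(∑ pᵢ²)` has a sharp satisfiability threshold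
at `m*(n) = (∑ pᵢ²)⁻¹`. -/
theorem nonuniform_2SAT_sharp_threshold
    (p : ℕ → ℕ → ℝ) (hp : ProbEnsemble p)
    (ho : (fun n => p n 0 ^ 2) =o[atTop] fun n => ∑ i ∈ Finset.range n, p n i ^ 2) :
    ∀ ε : ℝ, 0 < ε →
      (∀ m : ℕ → ℕ,
        (∀ᶠ n in atTop, (m n : ℝ) ≤ (1 - ε) * (∑ i ∈ Finset.range n, p n i ^ 2)⁻¹) →
        Tendsto (fun n => probSat2 n (m n) (p n)) atTop (nhds 1)) ∧
      (∀ m : ℕ → ℕ,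
        (∀ᶠ n in atTop, (1 + ε) * (∑ i ∈ Finset.range n, p n i ^ 2)⁻¹ ≤ (m n : ℝ)) →
        Tendsto (fun n => probSat2 n (m n) (p n)) atTop (nhds 0)) := by
  have hl : Tendsto (fun n => p n 0 ^ 2 / ∑ i ∈ Finset.range n, p n i ^ 2) atTop (nhds 0) :=
    ho.tendsto_div_nhds_zero
  have hSl : ∀ n, 1 ≤ n → 0 < ∑ i ∈ Finset.range n, p n i ^ 2 ∧ ∑ i ∈ Finset.range n, p n i ^ 2 ≤
      p n 0 ^ 2 / ∑ i ∈ Finset.range n, p n i ^ 2 := by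
    intro n hn
    obtain ⟨h1, h2, h3⟩ := hp n hn
    have hS : 0 < ∑ i ∈ Finset.range n, p n i ^ 2 :=
      Finset.sum_pos (fun i hi => pow_pos (h3 i (Finset.mem_range.mp hi)) 2) ⟨0, by simp; omega⟩
    refine ⟨hS, ?_⟩
    have h4 : ∑ i ∈ Finset.range n, p n i ^ 2 ≤ p n 0 := by
      calc ∑ i ∈ Finset.range n, p n i ^ 2 ≤ ∑ i ∈ Finset.range n, p n 0 * p n i := by
            refine Finset.sum_le_sum fun i hi => ?_
            have hi := Finset.mem_range.mp hi
            rw [sq]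
            exact mul_le_mul_of_nonneg_right (h2 0 i (by omega) hi) (h3 i hi).le
        _ = p n 0 := by rw [← Finset.mul_sum, h1, mul_one]
    rw [le_div_iff₀ hS, ← sq]
    exact pow_le_pow_left₀ hS.le h4 2
  have hsmall : ∀ δ : ℝ, 0 < δ → ∀ᶠ n in atTop, 1 ≤ n ∧ GoodP n (p n) ∧
      ∑ i ∈ Finset.range n, p n i ^ 2 ≤ δ ∧ p n 0 ^ 2 / (∑ i ∈ Finset.range n, p n i ^ 2) ≤ δ := by
    intro δ hδ
    have h1 := hl.eventually (gt_mem_nhds (lt_min hδ one_pos))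
    filter_upwards [h1, eventually_ge_atTop 1] with n hn1 hn
    obtain ⟨hS, hS2⟩ := hSl n hn
    have h4 := lt_of_lt_of_le hn1 (min_le_left _ _)
    have h5 := lt_of_lt_of_le hn1 (min_le_right _ _)
    refine ⟨hn, ⟨?_, fun i => (hp n hn).2.2 i i.2, by linarith⟩, by linarith, by linarith⟩
    rw [← (hp n hn).1, Finset.sum_range]
  intro ε hε
  constructor
  · intro m hm
    set e := min ε (1 / 2) with he
    have he0 : 0 < e := lt_min hε (by norm_num)
    have he1 : e ≤ 1 / 2 := min_le_right _ _
    have hle : e ≤ ε := min_le_left _ _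
    have hlow : ∀ᶠ n in atTop, 1 - (∑' K : ℕ, (K:ℝ) ^ 2 * (1 - e / 2) ^ K) *
        (2 * (p n 0 ^ 2 / ∑ i ∈ Finset.range n, p n i ^ 2)) ≤ probSat2 n (m n) (p n) := by
      filter_upwards [hm, hsmall (e / 4) (by positivity)] with n h1 ⟨hn, hg, h2, _⟩
      have hS := hg.Spos
      set S := ∑ i ∈ Finset.range n, p n i ^ 2 with hSd
      have := partOne (m := m n) (r := 1 - e / 2) hg
        (fun i => (hp n hn).2.1 0 i (Nat.zero_le _) i.2) (by linarith) (by linarith) (by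
          rw [← hSd]
          have h3 : (m n : ℝ) * S ≤ 1 - e := by
            have := mul_le_mul_of_nonneg_right h1 hS.le
            rw [mul_assoc, inv_mul_cancel₀ hS.ne'] at this
            linarith
          have h4 : 0 < 1 - S := by linarith
          have h5 : (m n : ℝ) * (1 - S)⁻¹ * S = (m n * S) / (1 - S) := by field_simp
          rw [h5, div_le_iff₀ h4]
          nlinarith)
      rw [← hSd, mul_div_assoc] at this
      linarith
    have hup : ∀ᶠ n in atTop, probSat2 n (m n) (p n) ≤ 1 := by
      filter_upwards [hsmall 1 one_pos] with n ⟨hn, hg, _⟩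
      rw [probSat_compl hg]
      have : 0 ≤ Ex (m n) (clauseProb2 n (p n)) (fun Φ => if Sat2 Φ then 0 else 1) := by
        refine (Ex_zero (m := m n) (w := clauseProb2 n (p n))).symm.le.trans ?_
        exact Ex_mono (clauseProb_nonneg hg) fun Φ _ => by split_ifs <;> norm_num
      linarith
    refine tendsto_of_tendsto_of_tendsto_of_le_of_le' ?_ tendsto_const_nhds hlow hup
    have := ((hl.const_mul 2).const_mul (∑' K : ℕ, (K:ℝ) ^ 2 * (1 - e / 2) ^ K)).const_sub 1
    simpa using this
  · intro m hm
    set e := min ε 1 with he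
    have he0 : 0 < e := lt_min hε one_pos
    have he1 : e ≤ 1 := min_le_right _ _
    have hle : e ≤ ε := min_le_left _ _
    obtain ⟨l0, hl0, K, hK⟩ := partTwo he0 he1
    have hup : ∀ᶠ n in atTop, probSat2 n (m n) (p n) ≤
        K * √(p n 0 ^ 2 / ∑ i ∈ Finset.range n, p n i ^ 2) := by
      filter_upwards [hm, hsmall (min l0 (1 / 4)) (by positivity)] with n h1 ⟨hn, hg, h2, h3⟩
      have hS := hg.Spos
      set S := ∑ i ∈ Finset.range n, p n i ^ 2 with hSd
      have hc1 := Nat.le_ceil ((1 + e) * S⁻¹)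
      have hc2 := (Nat.ceil_lt_add_one (by positivity : 0 ≤ (1 + e) * S⁻¹)).le
      have hmm : ⌈(1 + e) * S⁻¹⌉₊ ≤ m n := by
        refine Nat.ceil_le.mpr (le_trans ?_ h1)
        gcongr
      refine (probSat_anti hg hmm).trans ?_
      have a1 := mul_le_mul_of_nonneg_right hc1 hS.le
      have a2 := mul_le_mul_of_nonneg_right hc2 hS.le
      have a3 : (1 + e) * S⁻¹ * S = 1 + e := by rw [mul_assoc, inv_mul_cancel₀ hS.ne', mul_one]
      rw [add_mul _ 1 S, a3] at a2
      rw [a3] at a1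
      refine hK n _ (p n) hg (hp n hn).2.1 (h3.trans (min_le_left _ _))
        (h2.trans (min_le_right _ _)) ?_ ?_
      · rw [← hSd]; linarith
      · rw [← hSd]; linarith
    have hlow : ∀ᶠ n in atTop, 0 ≤ probSat2 n (m n) (p n) := by
      filter_upwards [hsmall 1 one_pos] with n ⟨hn, hg, _⟩
      exact probSat_nonneg hg
    refine tendsto_of_tendsto_of_tendsto_of_le_of_le' tendsto_const_nhds ?_ hlow hup
    have := ((Real.continuous_sqrt.tendsto 0).comp hl).const_mul K
    simpa using this
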